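/- Every hyperoctahedral category of partitions C satisfies exactly one of the following: (i) C = ⟨⊓⊓⟩; (ii) C contains the fat crossing partition but not the pair positioner partition; (iii) C is group-theoretical. -/

import Mathlib

/-!
Basic combinatorics of categories of partitions (Banica–Speicher easy quantum groups).

A partition with `k` upper and `l` lower points is encoded as an equivalence
relation (a `Setoid`) on the set `Fin k ⊕ Fin l` of its points; its blocks are
the equivalence classes.
-/

namespace EasyQG

/-- A partition of `k` upper and `l` lower points into blocks. -/
abbrev Partition (k l : ℕ) : Type := Setoid (Fin k ⊕ Fin l)

/-- The relation "lying in the same block" of a partition. -/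
def inSameBlock {k l : ℕ} (p : Partition k l) :
    (Fin k ⊕ Fin l) → (Fin k ⊕ Fin l) → Prop :=
  @Setoid.r _ p

/-- The partition in `P(0,n)` associated to a word: two points lie in the same
block iff they carry the same letter. -/
def ofWord {n : ℕ} (w : Fin n → ℕ) : Partition 0 n :=
  Setoid.ker (Sum.elim Fin.elim0 w)

/-- The partition in `P(0,n)` associated to a word given as a list of letters. -/
def ofList (w : List ℕ) : Partition 0 w.length :=
  ofWord w.get

/-- The identity partition `|` in `P(1,1)`: one upper point joined to one lower point. -/
def idPartition : Partition 1 1 := ⊤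

/-- The pair partition `⊓` in `P(0,2)`: two points in one block. -/
def pairPartition : Partition 0 2 := ⊤

/-- The double singleton `↓⊗↓` in `P(0,2)`: two points in two different blocks. -/
def doubleSingleton : Partition 0 2 := ⊥

/-- The four block partition `⊓⊓` in `P(0,4)`: four points in one block (word `aaaa`). -/
def fourBlock : Partition 0 4 := ⊤

/-- The fat crossing partition in `P(4,4)`, with blocks `{1,2,3',4'}` and `{3,4,1',2'}`. -/
def fatCross : Partition 4 4 :=
  Setoid.ker (Sum.elim (fun i => decide (i.val < 2)) (fun j => decide (2 ≤ j.val)))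

/-- The pair positioner partition in `P(3,3)`, with blocks `{1,2,2',3'}` and `{3,1'}`. -/
def pairPositioner : Partition 3 3 :=
  Setoid.ker (Sum.elim (fun i => decide (i.val < 2)) (fun j => decide (1 ≤ j.val)))

/-- The `s`-mixing partition `h_s ∈ P(0,2s)`, the word `abab…ab` of length `2s`. -/
def sMixing (s : ℕ) : Partition 0 (2 * s) := ofWord (fun i => i.val % 2)

/-- The partition `π_k ∈ P(0,4k)`, the word `a₁…a_k a_k…a₁ a₁…a_k a_k…a₁`
in `k` distinct letters. -/
def piPartition (k : ℕ) : Partition 0 (4 * k) :=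
  ofWord (fun i =>
    if i.val % (2 * k) < k then i.val % (2 * k) else 2 * k - 1 - i.val % (2 * k))

/-- The disjoint sum of two set partitions. -/
def sumSetoid {α β : Type*} (ra : Setoid α) (rb : Setoid β) : Setoid (α ⊕ β) where
  r := Sum.LiftRel (@Setoid.r _ ra) (@Setoid.r _ rb)
  iseqv := by
    constructor
    · intro x
      cases x with
      | inl a => exact Sum.LiftRel.inl (ra.iseqv.refl a)
      | inr b => exact Sum.LiftRel.inr (rb.iseqv.refl b)
    · intro x y h
      cases h with
      | inl h => exact Sum.LiftRel.inl (ra.iseqv.symm h)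
      | inr h => exact Sum.LiftRel.inr (rb.iseqv.symm h)
    · intro x y z h1 h2
      cases h1 with
      | inl h1 => cases h2 with
        | inl h2 => exact Sum.LiftRel.inl (ra.iseqv.trans h1 h2)
      | inr h1 => cases h2 with
        | inr h2 => exact Sum.LiftRel.inr (rb.iseqv.trans h1 h2)

/-- Tensor product (horizontal concatenation) of partitions. -/
def tensor {k l k' l' : ℕ} (p : Partition k l) (q : Partition k' l') :
    Partition (k + k') (l + l') :=
  Setoid.comap
    (fun x => (Equiv.sumSumSumComm (Fin k) (Fin k') (Fin l) (Fin l'))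
      (Sum.map finSumFinEquiv.symm finSumFinEquiv.symm x))
    (sumSetoid p q)

/-- Composition (vertical concatenation) of partitions `p ∈ P(k,l)` and `q ∈ P(l,m)`:
blocks are joined along the `l` middle points, which are then deleted. -/
def comp {k l m : ℕ} (p : Partition k l) (q : Partition l m) : Partition k m :=
  Setoid.comap (Sum.map id Sum.inr)
    (Relation.EqvGen.setoid (fun x y : Fin k ⊕ (Fin l ⊕ Fin m) =>
      (∃ a b, inSameBlock p a b ∧ Sum.map id Sum.inl a = x ∧ Sum.map id Sum.inl b = y) ∨
      (∃ a b, inSameBlock q a b ∧ Sum.inr a = x ∧ Sum.inr b = y)))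

/-- Involution (turning a partition upside down). -/
def involution {k l : ℕ} (p : Partition k l) : Partition l k :=
  Setoid.comap Sum.swap p

/-- Rotation moving the leftmost upper point to the left end of the lower row. -/
def rotUL {k l : ℕ} (p : Partition (k + 1) l) : Partition k (l + 1) :=
  Setoid.comap
    (Sum.elim (fun i => Sum.inl i.succ)
      (fun j => Fin.cases (Sum.inl (0 : Fin (k + 1))) (fun j' => Sum.inr j') j)) p

/-- Rotation moving the leftmost lower point to the left end of the upper row. -/
def rotLU {k l : ℕ} (p : Partition k (l + 1)) : Partition (k + 1) l :=
  Setoid.comap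
    (Sum.elim (fun i => Fin.cases (Sum.inr (0 : Fin (l + 1))) (fun i' => Sum.inl i') i)
      (fun j => Sum.inr j.succ)) p

/-- Rotation moving the rightmost upper point to the right end of the lower row. -/
def rotUR {k l : ℕ} (p : Partition (k + 1) l) : Partition k (l + 1) :=
  Setoid.comap
    (Sum.elim (fun i => Sum.inl i.castSucc)
      (fun j => Fin.lastCases (Sum.inl (Fin.last k)) (fun j' => Sum.inr j') j)) p

/-- Rotation moving the rightmost lower point to the right end of the upper row. -/
def rotRU {k l : ℕ} (p : Partition k (l + 1)) : Partition (k + 1) l :=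
  Setoid.comap
    (Sum.elim (fun i => Fin.lastCases (Sum.inr (Fin.last l)) (fun i' => Sum.inl i') i)
      (fun j => Sum.inr j.castSucc)) p

/-- A category of partitions: a collection of partitions containing the identity
partition and closed under the category operations (tensor product, composition,
involution and the four rotations). -/
structure PartitionCategory where
  mem : Set (Σ k l : ℕ, Partition k l)
  id_mem : ⟨1, 1, idPartition⟩ ∈ mem
  tensor_mem : ∀ {k l k' l' : ℕ} {p : Partition k l} {q : Partition k' l'},
    ⟨k, l, p⟩ ∈ mem → ⟨k', l', q⟩ ∈ mem → ⟨k + k', l + l', tensor p q⟩ ∈ mem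
  comp_mem : ∀ {k l m : ℕ} {p : Partition k l} {q : Partition l m},
    ⟨k, l, p⟩ ∈ mem → ⟨l, m, q⟩ ∈ mem → ⟨k, m, comp p q⟩ ∈ mem
  involution_mem : ∀ {k l : ℕ} {p : Partition k l},
    ⟨k, l, p⟩ ∈ mem → ⟨l, k, involution p⟩ ∈ mem
  rotUL_mem : ∀ {k l : ℕ} {p : Partition (k + 1) l},
    ⟨k + 1, l, p⟩ ∈ mem → ⟨k, l + 1, rotUL p⟩ ∈ mem
  rotLU_mem : ∀ {k l : ℕ} {p : Partition k (l + 1)},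
    ⟨k, l + 1, p⟩ ∈ mem → ⟨k + 1, l, rotLU p⟩ ∈ mem
  rotUR_mem : ∀ {k l : ℕ} {p : Partition (k + 1) l},
    ⟨k + 1, l, p⟩ ∈ mem → ⟨k, l + 1, rotUR p⟩ ∈ mem
  rotRU_mem : ∀ {k l : ℕ} {p : Partition k (l + 1)},
    ⟨k, l + 1, p⟩ ∈ mem → ⟨k + 1, l, rotRU p⟩ ∈ mem

/-- The members of the smallest category of partitions containing `S`
(the category `⟨S⟩` generated by `S`). -/
def generated (S : Set (Σ k l : ℕ, Partition k l)) : Set (Σ k l : ℕ, Partition k l) :=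
  {x | ∀ C : PartitionCategory, S ⊆ C.mem → x ∈ C.mem}

/-- A category of partitions is hyperoctahedral if it contains the four block
partition `⊓⊓` but not the double singleton `↓⊗↓`. -/
def Hyperoctahedral (C : PartitionCategory) : Prop :=
  (⟨0, 4, fourBlock⟩ : Σ k l : ℕ, Partition k l) ∈ C.mem ∧
    (⟨0, 2, doubleSingleton⟩ : Σ k l : ℕ, Partition k l) ∉ C.mem

/-- A category of partitions is group-theoretical if it contains the pair
positioner partition. -/
def GroupTheoretical (C : PartitionCategory) : Prop :=
  (⟨3, 3, pairPositioner⟩ : Σ k l : ℕ, Partition k l) ∈ C.mem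

/-- The generating set `{π_l | 1 ≤ l ≤ k}`. -/
def piUpTo (k : ℕ) : Set (Σ k l : ℕ, Partition k l) :=
  {x | ∃ l : ℕ, 1 ≤ l ∧ l ≤ k ∧ x = ⟨0, 4 * l, piPartition l⟩}

/-- The generating set `{π_l | l ∈ ℕ, l ≥ 1}`. -/
def piAll : Set (Σ k l : ℕ, Partition k l) :=
  {x | ∃ l : ℕ, 1 ≤ l ∧ x = ⟨0, 4 * l, piPartition l⟩}

end EasyQG
namespace EasyQG

/-- Merging the blocks of the points `x` and `y` of a partition. -/
def merge {k l : ℕ} (p : Partition k l) (x y : Fin k ⊕ Fin l) : Partition k l :=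
  Relation.EqvGen.setoid (fun u v => inSameBlock p u v ∨ (u = x ∧ v = y) ∨ (u = y ∧ v = x))

/-- The word `a_{i(1)}^{k(1)} … a_{i(m)}^{k(m)}` determined by a list of
letters with exponents. -/
def expand (blocks : List (ℕ × ℕ)) : List ℕ :=
  (blocks.map fun be => List.replicate be.2 be.1).flatten

/-- The run decomposition of a word: the list of its (letter, exponent) blocks. -/
def runs : List ℕ → List (ℕ × ℕ)
  | [] => []
  | a :: rest =>
    match runs rest with
    | [] => [(a, 1)]
    | (b, e) :: rs => if a = b then (b, e + 1) :: rs else (a, 1) :: (b, e) :: rs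

/-- The single-double leg form associated to a word: every odd exponent is
replaced by `1` and every even exponent by `2`. -/
def sdForm (w : List ℕ) : List ℕ :=
  expand ((runs w).map fun be => (be.1, if Odd be.2 then 1 else 2))

/-- A word is in single-double leg form if all its exponents are `1` or `2`. -/
def IsSingleDoubleLegForm (w : List ℕ) : Prop :=
  ∃ blocks : List (ℕ × ℕ), List.Chain' (fun x y => x.1 ≠ y.1) blocks ∧
    (∀ b ∈ blocks, b.2 = 1 ∨ b.2 = 2) ∧ w = expand blocks

/-- The vertical reflection of a partition: the left-to-right order of the
points is reversed in both rows, keeping the block structure. -/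
def verticalReflect {k l : ℕ} (p : Partition k l) : Partition k l :=
  Setoid.comap (Sum.map Fin.rev Fin.rev) p

/-- `leg [a₁,…,a_k] [X₁,…,X_{k-1}] = a₁ X₁ a₂ X₂ … a_{k-1} X_{k-1} a_k`:
a list of letters interleaved with filler words. -/
def leg : List ℕ → List (List ℕ) → List ℕ
  | [], _ => []
  | [a], _ => [a]
  | a :: rest, Xs => a :: (Xs.headD [] ++ leg rest Xs.tail)

/-- A word contains a W of depth `k` if it can be written as
`Y₁ S_α X_k^α S_β Y₂ S_γ X_k^γ S_δ Y₃`, where `S_α = a₁X₁^α a₂X₂^α…a_k`,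
`S_β = a_k X_{k-1}^β…X₁^β a₁`, `S_γ = a₁X₁^γ…a_k`, `S_δ = a_k X_{k-1}^δ…X₁^δ a₁`
for `k` distinct letters `a₁,…,a_k`, each of which occurs an odd number of
times in each of `S_α`, `S_β`, `S_γ`, `S_δ`. -/
def ContainsW (w : List ℕ) (k : ℕ) : Prop :=
  ∃ (as : List ℕ) (Xa Xb Xc Xd : List (List ℕ)) (Xka Xkc Y1 Y2 Y3 : List ℕ),
    as.length = k ∧ as.Nodup ∧
    Xa.length = k - 1 ∧ Xb.length = k - 1 ∧ Xc.length = k - 1 ∧ Xd.length = k - 1 ∧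
    w = Y1 ++ leg as Xa ++ Xka ++ leg as.reverse Xb ++ Y2 ++
        leg as Xc ++ Xkc ++ leg as.reverse Xd ++ Y3 ∧
    ∀ a ∈ as, Odd ((leg as Xa).count a) ∧ Odd ((leg as.reverse Xb).count a) ∧
      Odd ((leg as Xc).count a) ∧ Odd ((leg as.reverse Xd).count a)

/-- `wdepth w` is the maximal `k` such that some rotated version of the
word `w` contains a W of depth `k`. -/
noncomputable def wdepth (w : List ℕ) : ℕ :=
  sSup {k | ∃ r : ℕ, ContainsW (w.rotate r) k}

end EasyQG

namespace EasyQG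

/-! ### Partitions described by two words -/

/-- The partition with upper points coloured by `u` and lower points by `v`. -/
def col (k l : ℕ) (u v : List ℕ) : Partition k l :=
  Setoid.ker (Sum.elim (fun i : Fin k => u.getD i.val 0) (fun j : Fin l => v.getD j.val 0))

/-- The partition given by the words `u` (upper row) and `v` (lower row). -/
def tw (u v : List ℕ) : Σ k l : ℕ, Partition k l :=
  ⟨u.length, v.length, col u.length v.length u v⟩

theorem tw_eq {k l : ℕ} {u v : List ℕ} (hu : u.length = k) (hv : v.length = l) :
    (⟨k, l, col k l u v⟩ : Σ k l : ℕ, Partition k l) = tw u v := by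
  subst hu hv; rfl

theorem tw_inv {k l : ℕ} {u v : List ℕ} {p : Partition k l}
    (h : (⟨k, l, p⟩ : Σ k l : ℕ, Partition k l) = tw u v) :
    u.length = k ∧ v.length = l ∧ p = col k l u v := by
  unfold tw at h
  cases h
  exact ⟨rfl, rfl, rfl⟩

theorem comap_ker {α β γ : Type*} (f : α → β) (g : β → γ) :
    Setoid.comap f (Setoid.ker g) = Setoid.ker (g ∘ f) := rfl

theorem exists_tw {k l : ℕ} (p : Partition k l) :
    ∃ u v : List ℕ, u.length = k ∧ v.length = l ∧ p = col k l u v := by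
  classical
  obtain ⟨e, he⟩ := exists_injective_nat (Quotient p)
  refine ⟨List.ofFn fun i : Fin k => e (Quotient.mk p (Sum.inl i)),
    List.ofFn fun i : Fin l => e (Quotient.mk p (Sum.inr i)), by simp, by simp, ?_⟩
  ext x y
  have hcol : ∀ z : Fin k ⊕ Fin l, Sum.elim
      (fun i : Fin k => (List.ofFn fun i : Fin k => e (Quotient.mk p (Sum.inl i))).getD i.val 0)
      (fun j : Fin l => (List.ofFn fun i : Fin l => e (Quotient.mk p (Sum.inr i))).getD j.val 0) z
      = e (Quotient.mk p z) := by
    rintro (i | i) <;> simp [List.getD]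
  unfold col
  rw [Setoid.ker_def, hcol, hcol, he.eq_iff, Quotient.eq]

theorem rotUL_col {k l : ℕ} (x : ℕ) (u v : List ℕ) :
    rotUL (col (k + 1) l (x :: u) v) = col k (l + 1) u (x :: v) := by
  unfold rotUL col
  rw [comap_ker]
  congr 1
  funext z
  rcases z with i | j
  · simp
  · refine Fin.cases ?_ (fun j => ?_) j <;> simp

theorem rotLU_col {k l : ℕ} (x : ℕ) (u v : List ℕ) :
    rotLU (col k (l + 1) u (x :: v)) = col (k + 1) l (x :: u) v := by
  unfold rotLU col
  rw [comap_ker]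
  congr 1
  funext z
  rcases z with j | i
  · refine Fin.cases ?_ (fun j => ?_) j <;> simp
  · simp

theorem getD_append_l {u v : List ℕ} {i : ℕ} (h : i < u.length) :
    (u ++ v).getD i 0 = u.getD i 0 := List.getD_append _ _ _ _ h

theorem getD_append_r {u v : List ℕ} {i k : ℕ} (h : u.length = k) :
    (u ++ v).getD (k + i) 0 = v.getD i 0 := by
  rw [List.getD_append_right _ _ _ _ (by omega)]
  congr 1; omega

theorem rotUR_col {k l : ℕ} (x : ℕ) (u v : List ℕ) (hu : u.length = k) (hv : v.length = l) :
    rotUR (col (k + 1) l (u ++ [x]) v) = col k (l + 1) u (v ++ [x]) := by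
  unfold rotUR col
  rw [comap_ker]
  congr 1
  have e1 : (u ++ [x]).getD k 0 = x := by
    simpa using getD_append_r (v := [x]) (i := 0) hu
  have e2 : (v ++ [x]).getD l 0 = x := by
    simpa using getD_append_r (v := [x]) (i := 0) hv
  funext z
  rcases z with i | j
  · have := getD_append_l (v := [x]) (show i.val < u.length by omega)
    simpa using this
  · refine Fin.lastCases ?_ (fun j => ?_) j
    · simp only [Function.comp, Sum.elim_inr, Fin.lastCases_last, Sum.elim_inl, Fin.val_last]
      rw [e1, e2]
    · have := getD_append_l (v := [x]) (show j.val < v.length by omega)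
      simpa using this.symm

theorem rotRU_col {k l : ℕ} (x : ℕ) (u v : List ℕ) (hu : u.length = k) (hv : v.length = l) :
    rotRU (col k (l + 1) u (v ++ [x])) = col (k + 1) l (u ++ [x]) v := by
  unfold rotRU col
  rw [comap_ker]
  congr 1
  have e1 : (u ++ [x]).getD k 0 = x := by
    simpa using getD_append_r (v := [x]) (i := 0) hu
  have e2 : (v ++ [x]).getD l 0 = x := by
    simpa using getD_append_r (v := [x]) (i := 0) hv
  funext z
  rcases z with j | i
  · refine Fin.lastCases ?_ (fun j => ?_) j
    · simp only [Function.comp, Sum.elim_inr, Fin.lastCases_last, Sum.elim_inl, Fin.val_last]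
      rw [e1, e2]
    · have := getD_append_l (v := [x]) (show j.val < u.length by omega)
      simpa using this.symm
  · have := getD_append_l (v := [x]) (show i.val < v.length by omega)
    simpa using this

theorem involution_col {k l : ℕ} (u v : List ℕ) :
    involution (col k l u v) = col l k v u := by
  unfold involution col
  rw [comap_ker]
  congr 1
  funext z
  rcases z with i | i <;> rfl

theorem getD_mem {u : List ℕ} {i : ℕ} (h : i < u.length) : u.getD i 0 ∈ u := by
  rw [List.getD_eq_getElem _ _ h]; exact List.getElem_mem h

theorem tensor_col {k l k' l' : ℕ} (u v u' v' : List ℕ) (hu : u.length = k) (hv : v.length = l)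
    (hu' : u'.length = k') (hv' : v'.length = l')
    (hd : ∀ a ∈ u ++ v, a ∉ u' ++ v') :
    tensor (col k l u v) (col k' l' u' v') = col (k + k') (l + l') (u ++ u') (v ++ v') := by
  -- the colour of a point, read off from the two tensor factors
  have hcol : ∀ z : Fin (k + k') ⊕ Fin (l + l'),
      Sum.elim (fun i : Fin (k + k') => (u ++ u').getD i.val 0)
        (fun j : Fin (l + l') => (v ++ v').getD j.val 0) z =
      Sum.elim (Sum.elim (fun i : Fin k => u.getD i.val 0) (fun j : Fin l => v.getD j.val 0))
        (Sum.elim (fun i : Fin k' => u'.getD i.val 0) (fun j : Fin l' => v'.getD j.val 0))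
        ((Equiv.sumSumSumComm (Fin k) (Fin k') (Fin l) (Fin l'))
          (Sum.map finSumFinEquiv.symm finSumFinEquiv.symm z)) := by
    rintro (i | i)
    · refine Fin.addCases (fun i => ?_) (fun i => ?_) i
      · simpa using getD_append_l (v := u') (show i.val < u.length by omega)
      · simpa using getD_append_r (v := u') (i := i.val) hu
    · refine Fin.addCases (fun i => ?_) (fun i => ?_) i
      · simpa using getD_append_l (v := v') (show i.val < v.length by omega)
      · simpa using getD_append_r (v := v') (i := i.val) hv
  have m1 : ∀ z : Fin k ⊕ Fin l, Sum.elim (fun i : Fin k => u.getD i.val 0)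
      (fun j : Fin l => v.getD j.val 0) z ∈ u ++ v := by
    rintro (i | i)
    · exact List.mem_append_left _ (getD_mem (by omega))
    · exact List.mem_append_right _ (getD_mem (by omega))
  have m2 : ∀ z : Fin k' ⊕ Fin l', Sum.elim (fun i : Fin k' => u'.getD i.val 0)
      (fun j : Fin l' => v'.getD j.val 0) z ∈ u' ++ v' := by
    rintro (i | i)
    · exact List.mem_append_left _ (getD_mem (by omega))
    · exact List.mem_append_right _ (getD_mem (by omega))
  ext x y
  unfold tensor
  rw [Setoid.comap_rel]
  conv_rhs => unfold col
  rw [Setoid.ker_def, hcol, hcol]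
  generalize ((Equiv.sumSumSumComm (Fin k) (Fin k') (Fin l) (Fin l'))
          (Sum.map finSumFinEquiv.symm finSumFinEquiv.symm x)) = X
  generalize ((Equiv.sumSumSumComm (Fin k) (Fin k') (Fin l) (Fin l'))
          (Sum.map finSumFinEquiv.symm finSumFinEquiv.symm y)) = Y
  change Sum.LiftRel _ _ X Y ↔ _
  rcases X with X | X <;> rcases Y with Y | Y
  · rw [Sum.liftRel_inl_inl]; exact Iff.rfl
  · simp only [Sum.not_liftRel_inl_inr, Sum.elim_inl, Sum.elim_inr, false_iff]
    intro h
    exact hd _ (m1 X) (h ▸ m2 Y)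
  · simp only [Sum.not_liftRel_inr_inl, Sum.elim_inl, Sum.elim_inr, false_iff]
    intro h
    exact hd _ (m1 Y) (h ▸ m2 X)
  · rw [Sum.liftRel_inr_inr]; exact Iff.rfl

theorem getD_map' {u : List ℕ} {i : ℕ} (f : ℕ → ℕ) (h : i < u.length) :
    (u.map f).getD i 0 = f (u.getD i 0) := by
  rw [List.getD_eq_getElem _ _ h, List.getD_eq_getElem _ _ (by simpa using h), List.getElem_map]

/-- Composition of partitions in terms of colours. The list `L` holds the pairs of letters which
are glued; `σ` realises the gluing. -/
theorem comp_col {k l n : ℕ} (u v : List ℕ) (L : List (ℕ × ℕ)) (hu : u.length = k)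
    (hL : L.length = l) (hv : v.length = n)
    (hd : ∀ a ∈ u ++ L.map Prod.fst, a ∉ L.map Prod.snd ++ v) (σ : ℕ → ℕ)
    (h1 : ∀ c ∈ L, σ c.1 = σ c.2)
    (h2 : ∀ c, Relation.EqvGen (fun a b => (a, b) ∈ L) c (σ c)) :
    comp (col k l u (L.map Prod.fst)) (col l n (L.map Prod.snd) v) =
      col k n (u.map σ) (v.map σ) := by
  have hg : ∀ i : Fin l, ((L.map Prod.fst).getD i.val 0, (L.map Prod.snd).getD i.val 0) ∈ L := by
    intro i
    have hi : i.val < L.length := by omega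
    rw [List.getD_eq_getElem _ _ (by simpa using hi), List.getD_eq_getElem _ _ (by simpa using hi)]
    simp
  have hg' : ∀ a b, (a, b) ∈ L → ∃ i : Fin l,
      (L.map Prod.fst).getD i.val 0 = a ∧ (L.map Prod.snd).getD i.val 0 = b := by
    intro a b hab
    obtain ⟨i, hi, he⟩ := List.mem_iff_getElem.1 hab
    refine ⟨⟨i, by omega⟩, ?_, ?_⟩
    · rw [List.getD_eq_getElem _ _ (by simpa using hi)]; simp [he]
    · rw [List.getD_eq_getElem _ _ (by simpa using hi)]; simp [he]
  ext x y
  unfold comp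
  rw [Setoid.comap_rel]
  set R : Fin k ⊕ (Fin l ⊕ Fin n) → Fin k ⊕ (Fin l ⊕ Fin n) → Prop := fun x y =>
      (∃ a b, inSameBlock (col k l u (L.map Prod.fst)) a b ∧
        Sum.map id Sum.inl a = x ∧ Sum.map id Sum.inl b = y) ∨
      (∃ a b, inSameBlock (col l n (L.map Prod.snd) v) a b ∧ Sum.inr a = x ∧ Sum.inr b = y)
    with hR
  have hcol : ∀ z : Fin k ⊕ Fin n,
      Sum.elim (fun i : Fin k => (u.map σ).getD i.val 0)
        (fun j : Fin n => (v.map σ).getD j.val 0) z =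
      σ (Sum.elim (fun i : Fin k => u.getD i.val 0) (fun j : Fin n => v.getD j.val 0) z) := by
    rintro (i | i)
    · exact getD_map' σ (by omega)
    · exact getD_map' σ (by omega)
  change Relation.EqvGen R (Sum.map id Sum.inr x) (Sum.map id Sum.inr y) ↔ _
  conv_rhs => unfold col
  rw [Setoid.ker_def, hcol, hcol]
  constructor
  · intro h
    let F : Fin k ⊕ (Fin l ⊕ Fin n) → ℕ :=
      Sum.elim (fun i => σ (u.getD i.val 0))
        (Sum.elim (fun i => σ ((L.map Prod.fst).getD i.val 0)) (fun i => σ (v.getD i.val 0)))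
    have key : ∀ X Y, Relation.EqvGen R X Y → F X = F Y := by
      intro X Y hXY
      induction hXY with
      | rel X Y h =>
        rcases h with ⟨a, b, hab, rfl, rfl⟩ | ⟨a, b, hab, rfl, rfl⟩
        · have hF : ∀ a : Fin k ⊕ Fin l, F (Sum.map id Sum.inl a) =
              σ (Sum.elim (fun i : Fin k => u.getD i.val 0)
                (fun j : Fin l => (L.map Prod.fst).getD j.val 0) a) := by
            rintro (a | a) <;> rfl
          rw [hF, hF]
          exact congrArg σ hab
        · have hF : ∀ a : Fin l ⊕ Fin n, F (Sum.inr a) =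
              σ (Sum.elim (fun i : Fin l => (L.map Prod.snd).getD i.val 0)
                (fun j : Fin n => v.getD j.val 0) a) := by
            rintro (a | a)
            · exact h1 _ (hg a)
            · rfl
          rw [hF, hF]
          exact congrArg σ hab
      | refl => rfl
      | symm _ _ _ ih => exact ih.symm
      | trans _ _ _ _ _ ih1 ih2 => exact ih1.trans ih2
    have := key _ _ h
    rcases x with x | x <;> rcases y with y | y <;> exact this
  · intro h
    -- a point of the composed diagram carries a letter
    let Has : Fin k ⊕ (Fin l ⊕ Fin n) → ℕ → Prop := fun X c =>
      (∃ a : Fin k ⊕ Fin l, Sum.map id Sum.inl a = X ∧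
        Sum.elim (fun i : Fin k => u.getD i.val 0)
                (fun j : Fin l => (L.map Prod.fst).getD j.val 0) a = c) ∨
      (∃ a : Fin l ⊕ Fin n, Sum.inr a = X ∧
        Sum.elim (fun i : Fin l => (L.map Prod.snd).getD i.val 0)
                (fun j : Fin n => v.getD j.val 0) a = c)
    have m1 : ∀ a : Fin k ⊕ Fin l, Sum.elim (fun i : Fin k => u.getD i.val 0)
                (fun j : Fin l => (L.map Prod.fst).getD j.val 0) a ∈ u ++ L.map Prod.fst := by
      rintro (i | i)
      · exact List.mem_append_left _ (getD_mem (by omega))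
      · exact List.mem_append_right _ (getD_mem (by simp; omega))
    have m2 : ∀ a : Fin l ⊕ Fin n, Sum.elim (fun i : Fin l => (L.map Prod.snd).getD i.val 0)
                (fun j : Fin n => v.getD j.val 0) a ∈ L.map Prod.snd ++ v := by
      rintro (i | i)
      · exact List.mem_append_left _ (getD_mem (by simp; omega))
      · exact List.mem_append_right _ (getD_mem (by omega))
    have same : ∀ c X Y, Has X c → Has Y c → Relation.EqvGen R X Y := by
      rintro c X Y (⟨a, rfl, ha⟩ | ⟨a, rfl, ha⟩) (⟨b, rfl, hb⟩ | ⟨b, rfl, hb⟩)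
      · exact Relation.EqvGen.rel _ _ (Or.inl ⟨a, b, ha.trans hb.symm, rfl, rfl⟩)
      · exact absurd (hb ▸ m2 b) (hd _ (ha ▸ m1 a))
      · exact absurd (ha ▸ m2 a) (hd _ (hb ▸ m1 b))
      · exact Relation.EqvGen.rel _ _ (Or.inr ⟨a, b, ha.trans hb.symm, rfl, rfl⟩)
    have key : ∀ c d, Relation.EqvGen (fun a b => (a, b) ∈ L) c d →
        (∀ X Y, Has X c → Has Y d → Relation.EqvGen R X Y) ∧ ((∃ X, Has X c) ↔ ∃ Y, Has Y d) := by
      intro c d hcd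
      induction hcd with
      | rel c d h =>
        obtain ⟨i, rfl, rfl⟩ := hg' c d h
        have a1 : Has (Sum.inr (Sum.inl i)) ((L.map Prod.fst).getD i.val 0) :=
          Or.inl ⟨Sum.inr i, rfl, rfl⟩
        have a2 : Has (Sum.inr (Sum.inl i)) ((L.map Prod.snd).getD i.val 0) :=
          Or.inr ⟨Sum.inl i, rfl, rfl⟩
        exact ⟨fun X Y hX hY => (same _ _ _ hX a1).trans _ _ _ (same _ _ _ a2 hY),
          fun _ => ⟨_, a2⟩, fun _ => ⟨_, a1⟩⟩
      | refl c => exact ⟨fun X Y hX hY => same _ _ _ hX hY, Iff.rfl⟩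
      | symm _ _ _ ih => exact ⟨fun X Y hX hY => (ih.1 Y X hY hX).symm _ _, ih.2.symm⟩
      | trans _ _ _ _ _ ih1 ih2 =>
        refine ⟨fun X Y hX hY => ?_, ih1.2.trans ih2.2⟩
        obtain ⟨Z, hZ⟩ := ih1.2.1 ⟨X, hX⟩
        exact (ih1.1 _ _ hX hZ).trans _ _ _ (ih2.1 _ _ hZ hY)
    have hh : ∀ z : Fin k ⊕ Fin n, Has (Sum.map id Sum.inr z)
        (Sum.elim (fun i : Fin k => u.getD i.val 0) (fun j : Fin n => v.getD j.val 0) z) := by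
      rintro (i | i)
      · exact Or.inl ⟨Sum.inl i, rfl, rfl⟩
      · exact Or.inr ⟨Sum.inr i, rfl, rfl⟩
    refine (key _ _ ?_).1 _ _ (hh x) (hh y)
    refine (h2 _).trans _ _ _ ?_
    rw [h]
    exact (h2 _).symm _ _

/-! ### Noncrossing words -/

/-- A word is crossing if it contains `a…b…a…b` for two different letters `a`, `b`. -/
def Crossing (w : List ℕ) : Prop := ∃ a b : ℕ, a ≠ b ∧ [a, b, a, b].Sublist w

theorem Crossing.rot1 {x : ℕ} {w : List ℕ} (h : Crossing (w ++ [x])) : Crossing (x :: w) := by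
  obtain ⟨a, b, hab, h⟩ := h
  rw [List.sublist_append_iff] at h
  obtain ⟨l1, l2, he, h1, h2⟩ := h
  rw [List.sublist_singleton] at h2
  rcases h2 with rfl | rfl
  · exact ⟨a, b, hab, by rw [he, List.append_nil]; exact h1.cons x⟩
  · have he' : [a, b, a] ++ [b] = l1 ++ [x] := he
    obtain ⟨rfl, hx⟩ := List.append_inj' he' rfl
    obtain rfl : b = x := by simpa using hx
    exact ⟨b, a, hab.symm, h1.cons₂ b⟩

theorem Crossing.rev {w : List ℕ} (h : Crossing w) : Crossing w.reverse := by
  obtain ⟨a, b, hab, h⟩ := h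
  exact ⟨b, a, hab.symm, by simpa using h.reverse⟩

theorem crossing_rev {w : List ℕ} : Crossing w.reverse ↔ Crossing w :=
  ⟨fun h => by simpa using h.rev, Crossing.rev⟩

theorem Crossing.rot1' {x : ℕ} {w : List ℕ} (h : Crossing (x :: w)) : Crossing (w ++ [x]) := by
  have := h.rev
  rw [List.reverse_cons] at this
  have := this.rot1.rev
  simpa using this

theorem Crossing.rot {u v : List ℕ} (h : Crossing (u ++ v)) : Crossing (v ++ u) := by
  induction u generalizing v with
  | nil => simpa using h
  | cons x u ih =>
    have h' : Crossing ((u ++ v) ++ [x]) := Crossing.rot1' h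
    rw [List.append_assoc] at h'
    have := ih h'
    simpa using this

theorem crossing_of_map {f : ℕ → ℕ} {w : List ℕ} (h : Crossing (w.map f)) :
    ∃ a b c d, f a = f c ∧ f b = f d ∧ f a ≠ f b ∧ [a, b, c, d].Sublist w := by
  obtain ⟨a, b, hab, h⟩ := h
  rw [List.sublist_map_iff] at h
  obtain ⟨l, hl, he⟩ := h
  rcases l with _ | ⟨x, _ | ⟨y, _ | ⟨z, _ | ⟨t, _ | ⟨s, l⟩⟩⟩⟩⟩ <;> simp at he
  obtain ⟨rfl, rfl, e1, e2⟩ := he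
  exact ⟨x, y, z, t, e1, e2, hab, hl⟩

theorem crossing_map_inj {f : ℕ → ℕ} (hf : Function.Injective f) {w : List ℕ}
    (h : Crossing (w.map f)) : Crossing w := by
  obtain ⟨a, b, c, d, h1, h2, h3, h⟩ := crossing_of_map h
  obtain rfl := hf h1
  obtain rfl := hf h2
  exact ⟨a, b, fun e => h3 (by rw [e]), h⟩

theorem crossing_disjoint {w w' : List ℕ} (hd : ∀ a ∈ w, a ∉ w') (h : Crossing (w ++ w')) :
    Crossing w ∨ Crossing w' := by
  obtain ⟨a, b, hab, h⟩ := h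
  rw [List.sublist_append_iff] at h
  obtain ⟨l1, l2, he, h1, h2⟩ := h
  have hh : ∀ z, z ∈ l1 → z ∉ l2 := fun z hz hz' => hd z (h1.subset hz) (h2.subset hz')
  rcases l1 with _ | ⟨x, _ | ⟨y, _ | ⟨z, _ | ⟨t, _ | ⟨s, l⟩⟩⟩⟩⟩ <;> simp at he
  · subst he; exact Or.inr ⟨a, b, hab, h2⟩
  · obtain ⟨rfl, rfl⟩ := he; simp at hh
  · obtain ⟨rfl, rfl, rfl⟩ := he; simp at hh
  · obtain ⟨rfl, rfl, rfl, rfl⟩ := he; simp at hh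
  · obtain ⟨rfl, rfl, rfl, rfl, rfl⟩ := he; exact Or.inl ⟨a, b, hab, h1⟩

/-- The elementary gluing of the letter `x` to the letter `y`. -/
def glue (x y : ℕ) : ℕ → ℕ := fun z => if z = x then y else z

/-- Contracting two neighbouring points of a noncrossing word. -/
theorem crossing_contract {x y : ℕ} {w : List ℕ} (h : Crossing (w.map (glue x y))) :
    Crossing (w ++ [x, y]) := by
  obtain ⟨a, b, c, d, h1, h2, h3, h⟩ := crossing_of_map h
  have hxy : [x].Sublist [x, y] ∧ [y].Sublist [x, y] := by simp
  by_cases hac : a = c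
  · subst hac
    by_cases hbd : b = d
    · subst hbd
      exact ⟨a, b, fun e => h3 (by rw [e]), h.trans (List.sublist_append_left _ _)⟩
    · have hab : a ≠ b := fun e => h3 (by rw [e])
      have hb : b = x ∨ b = y := by unfold glue at h2; split_ifs at h2 <;> simp_all
      have h' : [a, b, a].Sublist w := List.Sublist.trans (by
        show ([a, b, a] : List ℕ).Sublist ([a, b, a] ++ [d])
        exact List.sublist_append_left _ _) h
      refine ⟨a, b, hab, ?_⟩
      show ([a, b, a] ++ [b]).Sublist _
      rcases hb with rfl | rfl
      · exact h'.append hxy.1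
      · exact h'.append hxy.2
  · have hbc : b ≠ c := fun e => h3 (by rw [h1, e])
    have hc : c = x ∨ c = y := by unfold glue at h1; split_ifs at h1 <;> simp_all
    have hbd : b = d := by
      unfold glue at h1 h2 h3; split_ifs at h1 h2 h3 <;> simp_all
    subst hbd
    have h' : [b, c, b].Sublist w := List.Sublist.trans (List.sublist_cons_self a _) h
    refine ⟨b, c, hbc, ?_⟩
    show ([b, c, b] ++ [c]).Sublist _
    rcases hc with rfl | rfl
    · exact h'.append hxy.1
    · exact h'.append hxy.2

theorem nc_glue (L : List (ℕ × ℕ)) : ∀ (u v : List ℕ),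
    ¬ Crossing (u ++ L.map Prod.fst ++ ((L.map Prod.snd).reverse ++ v)) →
    ∃ σ : ℕ → ℕ, (∀ c ∈ L, σ c.1 = σ c.2) ∧
      (∀ c, Relation.EqvGen (fun a b => (a, b) ∈ L) c (σ c)) ∧
      ¬ Crossing (u.map σ ++ v.map σ) := by
  induction hn : L.length generalizing L with
  | zero =>
    intro u v h
    obtain rfl := List.length_eq_zero_iff.1 hn
    exact ⟨id, by simp, fun c => Relation.EqvGen.refl _, by simpa using h⟩
  | succ n ih =>
    intro u v h
    rcases List.eq_nil_or_concat L with rfl | ⟨L, ⟨x, y⟩, rfl⟩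
    · simp at hn
    rw [List.concat_eq_append] at hn h ⊢
    have hg : ∀ c, Relation.EqvGen (fun a b => (a, b) ∈ L ++ [(x, y)]) c (glue x y c) := by
      intro c
      unfold glue
      split_ifs with hc
      · subst hc; exact Relation.EqvGen.rel _ _ (by simp)
      · exact Relation.EqvGen.refl _
    have h' : ¬ Crossing ((u ++ L.map Prod.fst ++ ((L.map Prod.snd).reverse ++ v)).map
        (glue x y)) := by
      intro hc
      rw [List.map_append] at hc
      have hc := hc.rot
      rw [← List.map_append] at hc
      have := crossing_contract hc
      apply h
      simp only [List.map_append, List.map_cons, List.map_nil, List.reverse_append,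
        List.reverse_cons, List.reverse_nil, List.nil_append, List.append_assoc] at this ⊢
      have h2 := Crossing.rot (u := (L.map Prod.snd).reverse ++ v)
        (v := u ++ (L.map Prod.fst ++ [x, y])) (by simpa using this)
      simpa using h2
    obtain ⟨σ, h1, h2, h3⟩ := ih (L.map fun c => (glue x y c.1, glue x y c.2)) (by simpa using hn)
      (u.map (glue x y)) (v.map (glue x y)) (by
        simpa [List.map_map, Function.comp_def, List.map_reverse] using h')
    refine ⟨σ ∘ glue x y, ?_, ?_, by simpa using h3⟩
    · intro c hc
      rw [List.mem_append, List.mem_singleton] at hc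
      rcases hc with hc | rfl
      · exact h1 (glue x y c.1, glue x y c.2) (List.mem_map.2 ⟨c, hc, rfl⟩)
      · simp [glue]
    · intro c
      refine (hg c).trans _ _ _ ?_
      have mono : ∀ e f, Relation.EqvGen
          (fun a b => (a, b) ∈ L.map fun c => (glue x y c.1, glue x y c.2)) e f →
          Relation.EqvGen (fun a b => (a, b) ∈ L ++ [(x, y)]) e f := by
        intro e f hef
        induction hef with
        | rel e f h =>
          obtain ⟨⟨a, b⟩, hab, heq⟩ := List.mem_map.1 h
          simp only [Prod.mk.injEq] at heq
          obtain ⟨rfl, rfl⟩ := heq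
          refine ((hg a).symm _ _).trans _ _ _ (Relation.EqvGen.trans _ _ _ ?_ (hg b))
          exact Relation.EqvGen.rel _ _ (by simp [hab])
        | refl => exact Relation.EqvGen.refl _
        | symm _ _ _ ih => exact ih.symm _ _
        | trans _ _ _ _ _ ih1 ih2 => exact ih1.trans _ _ _ ih2
      exact mono _ _ (h2 _)

theorem col_map_inj {k l : ℕ} {u v : List ℕ} (hu : u.length = k) (hv : v.length = l)
    {f : ℕ → ℕ} (hf : Function.Injective f) : col k l (u.map f) (v.map f) = col k l u v := by
  have hcol : ∀ z : Fin k ⊕ Fin l,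
      Sum.elim (fun i : Fin k => (u.map f).getD i.val 0)
        (fun j : Fin l => (v.map f).getD j.val 0) z =
      f (Sum.elim (fun i : Fin k => u.getD i.val 0) (fun j : Fin l => v.getD j.val 0) z) := by
    rintro (i | i)
    · exact getD_map' f (by omega)
    · exact getD_map' f (by omega)
  ext x y
  unfold col
  rw [Setoid.ker_def, Setoid.ker_def, hcol, hcol, hf.eq_iff]

/-- Noncrossing partitions. -/
def NC {k l : ℕ} (p : Partition k l) : Prop :=
  ∃ u v : List ℕ, u.length = k ∧ v.length = l ∧ p = col k l u v ∧ ¬ Crossing (u.reverse ++ v)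

theorem even_inj : Function.Injective (fun n : ℕ => 2 * n) := fun a b h => by simpa using h
theorem odd_inj : Function.Injective (fun n : ℕ => 2 * n + 1) := fun a b h => by simpa using h

theorem NC.rename {k l : ℕ} {p : Partition k l} (h : NC p) {f : ℕ → ℕ}
    (hf : Function.Injective f) :
    ∃ u v : List ℕ, u.length = k ∧ v.length = l ∧ p = col k l (u.map f) (v.map f) ∧
      ¬ Crossing ((u.map f).reverse ++ v.map f) := by
  obtain ⟨u, v, hu, hv, rfl, h⟩ := h
  refine ⟨u, v, hu, hv, (col_map_inj hu hv hf).symm, fun hc => h (crossing_map_inj hf ?_)⟩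
  simpa [List.map_reverse] using hc

theorem NC.tensor {k l k' l' : ℕ} {p : Partition k l} {q : Partition k' l'} (hp : NC p)
    (hq : NC q) : NC (tensor p q) := by
  obtain ⟨u, v, hu, hv, rfl, h⟩ := hp.rename even_inj
  obtain ⟨u', v', hu', hv', rfl, h'⟩ := hq.rename odd_inj
  have hd : ∀ a ∈ u.map (fun n => 2 * n) ++ v.map (fun n => 2 * n),
      a ∉ u'.map (fun n => 2 * n + 1) ++ v'.map (fun n => 2 * n + 1) := by
    intro a ha hb
    rw [← List.map_append, List.mem_map] at ha hb
    obtain ⟨m, _, rfl⟩ := ha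
    obtain ⟨n, _, hn⟩ := hb
    omega
  refine ⟨_, _, ?_, ?_, tensor_col _ _ _ _ (by simpa) (by simpa) (by simpa) (by simpa) hd, ?_⟩
  · simp [hu, hu']
  · simp [hv, hv']
  · generalize u.map (fun n => 2 * n) = U at *
    generalize v.map (fun n => 2 * n) = V at *
    generalize u'.map (fun n => 2 * n + 1) = U' at *
    generalize v'.map (fun n => 2 * n + 1) = V' at *
    intro hc
    have hc' : Crossing ((U.reverse ++ V) ++ (V' ++ U'.reverse)) := by
      have := Crossing.rot (u := U'.reverse) (v := U.reverse ++ V ++ V') (by simpa using hc)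
      simpa using this
    rcases crossing_disjoint (by
      intro a ha hb
      refine hd a (by simpa using ha) ?_
      simp only [List.mem_append, List.mem_reverse] at hb ⊢
      tauto) hc' with hc | hc
    · exact h hc
    · exact h' hc.rot

theorem NC.comp {k l m : ℕ} {p : Partition k l} {q : Partition l m} (hp : NC p)
    (hq : NC q) : NC (comp p q) := by
  obtain ⟨u, v, hu, hv, rfl, h⟩ := hp.rename even_inj
  obtain ⟨u', v', hu', hv', rfl, h'⟩ := hq.rename odd_inj
  have hd : ∀ a ∈ u.map (fun n => 2 * n) ++ v.map (fun n => 2 * n),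
      a ∉ u'.map (fun n => 2 * n + 1) ++ v'.map (fun n => 2 * n + 1) := by
    intro a ha hb
    rw [← List.map_append, List.mem_map] at ha hb
    obtain ⟨m, _, rfl⟩ := ha
    obtain ⟨n, _, hn⟩ := hb
    omega
  have hU : (u.map (fun n => 2 * n)).length = k := by simpa
  have hV : (v.map (fun n => 2 * n)).length = l := by simpa
  have hU' : (u'.map (fun n => 2 * n + 1)).length = l := by simpa
  have hV' : (v'.map (fun n => 2 * n + 1)).length = m := by simpa
  generalize u.map (fun n => 2 * n) = U at *
  generalize v.map (fun n => 2 * n) = V at *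
  generalize u'.map (fun n => 2 * n + 1) = U' at *
  generalize v'.map (fun n => 2 * n + 1) = V' at *
  have e1 : (V.zip U').map Prod.fst = V := List.map_fst_zip (by omega)
  have e2 : (V.zip U').map Prod.snd = U' := List.map_snd_zip (by omega)
  obtain ⟨σ, h1, h2, h3⟩ := nc_glue (V.zip U') U.reverse V' (by
    rw [e1, e2]
    intro hc
    rcases crossing_disjoint (by
      intro a ha hb
      refine hd a (by simpa using ha) (by simpa using hb)) hc with hc | hc
    · exact h hc
    · exact h' hc)
  refine ⟨U.map σ, V'.map σ, by simpa, by simpa, ?_, by simpa [List.map_reverse] using h3⟩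
  have := comp_col (l := l) U V' (V.zip U') hU (by simp [hV, hU']) hV' (by rw [e1, e2]; exact hd) σ h1 h2
  rwa [e1, e2] at this

theorem idPartition_eq : idPartition = col 1 1 [0] [0] := by
  ext x y
  have : ∀ z : Fin 1 ⊕ Fin 1, Sum.elim (fun i : Fin 1 => ([0] : List ℕ).getD i.val 0)
      (fun j : Fin 1 => ([0] : List ℕ).getD j.val 0) z = 0 := by decide
  unfold col
  rw [Setoid.ker_def, this, this]
  exact iff_of_true trivial rfl

theorem nc_id : NC idPartition := by
  refine ⟨[0], [0], rfl, rfl, idPartition_eq, ?_⟩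
  rintro ⟨a, b, hab, h⟩
  have := h.length_le
  simp at this

/-- The category of all noncrossing partitions. -/
def ncCat : PartitionCategory where
  mem := {s | NC s.2.2}
  id_mem := nc_id
  tensor_mem hp hq := NC.tensor hp hq
  comp_mem hp hq := NC.comp hp hq
  involution_mem := by
    intro k l p hp
    obtain ⟨u, v, hu, hv, rfl, h⟩ := (show NC p from hp)
    refine ⟨v, u, hv, hu, involution_col u v, fun hc => h ?_⟩
    simpa using hc.rev
  rotUL_mem := by
    intro k l p hp
    obtain ⟨u, v, hu, hv, rfl, h⟩ := (show NC p from hp)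
    rcases u with _ | ⟨x, u⟩
    · simp at hu
    · exact ⟨u, x :: v, by simpa using hu, by simpa using hv, rotUL_col x u v, by simpa using h⟩
  rotLU_mem := by
    intro k l p hp
    obtain ⟨u, v, hu, hv, rfl, h⟩ := (show NC p from hp)
    rcases v with _ | ⟨x, v⟩
    · simp at hv
    · exact ⟨x :: u, v, by simpa using hu, by simpa using hv, rotLU_col x u v, by simpa using h⟩
  rotUR_mem := by
    intro k l p hp
    obtain ⟨u, v, hu, hv, rfl, h⟩ := (show NC p from hp)
    rcases List.eq_nil_or_concat u with rfl | ⟨u, x, rfl⟩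
    · simp at hu
    · rw [List.concat_eq_append] at hu h hp ⊢
      have hu' : u.length = k := by simpa using hu
      refine ⟨u, v ++ [x], hu', by simpa using hv, rotUR_col x u v hu' hv, fun hc => h ?_⟩
      have := Crossing.rot1 (w := u.reverse ++ v) (x := x) (by simpa using hc)
      simpa using this
  rotRU_mem := by
    intro k l p hp
    obtain ⟨u, v, hu, hv, rfl, h⟩ := (show NC p from hp)
    rcases List.eq_nil_or_concat v with rfl | ⟨v, x, rfl⟩
    · simp at hv
    · rw [List.concat_eq_append] at hv h hp ⊢
      have hv' : v.length = l := by simpa using hv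
      refine ⟨u ++ [x], v, by simpa using hu, hv', rotRU_col x u v hu hv', fun hc => h ?_⟩
      have := Crossing.rot1' (w := u.reverse ++ v) (x := x) (by simpa using hc)
      simpa using this

theorem fourBlock_eq : fourBlock = col 0 4 [] [0, 0, 0, 0] := by
  ext x y
  have : ∀ z : Fin 0 ⊕ Fin 4, Sum.elim (fun i : Fin 0 => ([] : List ℕ).getD i.val 0)
      (fun j : Fin 4 => ([0, 0, 0, 0] : List ℕ).getD j.val 0) z = 0 := by decide
  unfold col
  rw [Setoid.ker_def, this, this]
  exact iff_of_true trivial rfl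

theorem fourBlock_nc : NC fourBlock := by
  refine ⟨[], [0, 0, 0, 0], rfl, rfl, fourBlock_eq, ?_⟩
  rintro ⟨a, b, hab, h⟩
  have := h.subset
  simp at this
  omega

theorem fatCross_not_nc : ¬ NC fatCross := by
  rintro ⟨u, v, hu, hv, h, hn⟩
  rcases u with _ | ⟨a, _ | ⟨b, _ | ⟨c, _ | ⟨d, _ | ⟨e, u⟩⟩⟩⟩⟩ <;> simp at hu
  rcases v with _ | ⟨a', _ | ⟨b', _ | ⟨c', _ | ⟨d', _ | ⟨e', u⟩⟩⟩⟩⟩ <;> simp at hv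
  have key : ∀ x y, fatCross x y ↔ (col 4 4 [a, b, c, d] [a', b', c', d']) x y := by
    intro x y; rw [← h]
  unfold fatCross col at key
  simp only [Setoid.ker_def] at key
  have k1 := key (Sum.inl 0) (Sum.inr 2)
  have k2 := key (Sum.inl 2) (Sum.inr 0)
  have k3 := key (Sum.inl 0) (Sum.inl 2)
  simp at k1 k2 k3
  apply hn
  subst k1 k2
  refine ⟨c, a, fun e => k3 e.symm, ?_⟩
  simp only [List.reverse_cons, List.reverse_nil, List.nil_append, List.cons_append]
  exact .cons _ (.cons_cons _ (.cons _ (.cons_cons _ (.cons_cons _ (.cons _ (.cons_cons _ (.cons _ .slnil)))))))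

theorem pairPositioner_not_nc : ¬ NC pairPositioner := by
  rintro ⟨u, v, hu, hv, h, hn⟩
  rcases u with _ | ⟨a, _ | ⟨b, _ | ⟨c, _ | ⟨d, u⟩⟩⟩⟩ <;> simp at hu
  rcases v with _ | ⟨a', _ | ⟨b', _ | ⟨c', _ | ⟨d', u⟩⟩⟩⟩ <;> simp at hv
  have key : ∀ x y, pairPositioner x y ↔ (col 3 3 [a, b, c] [a', b', c']) x y := by
    intro x y; rw [← h]
  unfold pairPositioner col at key
  simp only [Setoid.ker_def] at key
  have k1 := key (Sum.inl 0) (Sum.inr 1)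
  have k2 := key (Sum.inl 2) (Sum.inr 0)
  have k3 := key (Sum.inl 0) (Sum.inl 2)
  simp at k1 k2 k3
  apply hn
  subst k1 k2
  refine ⟨c, a, fun e => k3 e.symm, ?_⟩
  simp only [List.reverse_cons, List.reverse_nil, List.nil_append, List.cons_append]
  exact .cons_cons _ (.cons _ (.cons_cons _ (.cons_cons _ (.cons_cons _ (.cons _ .slnil)))))

theorem gen_nc {k l : ℕ} {p : Partition k l}
    (h : (⟨k, l, p⟩ : Σ k l : ℕ, Partition k l) ∈
      generated {(⟨0, 4, fourBlock⟩ : Σ k l : ℕ, Partition k l)}) : NC p :=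
  h ncCat (by rintro _ rfl; exact fourBlock_nc)

/-! ### Categories on the level of words -/

/-- The word `w` belongs to the category `C`. -/
def W (C : PartitionCategory) (w : List ℕ) : Prop := tw [] w ∈ C.mem

theorem tw_cons_iff {C : PartitionCategory} {x : ℕ} {u v : List ℕ} :
    tw (x :: u) v ∈ C.mem ↔ tw u (x :: v) ∈ C.mem := by
  constructor
  · intro h
    have := C.rotUL_mem (k := u.length) (l := v.length) (p := col _ _ (x :: u) v) h
    rw [rotUL_col] at this
    exact this
  · intro h
    have := C.rotLU_mem (k := u.length) (l := v.length) (p := col _ _ u (x :: v)) h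
    rw [rotLU_col] at this
    exact this

theorem tw_iff {C : PartitionCategory} {u v : List ℕ} :
    tw u v ∈ C.mem ↔ W C (u.reverse ++ v) := by
  induction u generalizing v with
  | nil => exact Iff.rfl
  | cons x u ih => rw [tw_cons_iff, ih]; simp

theorem W.rot1 {C : PartitionCategory} {x : ℕ} {w : List ℕ} (h : W C (x :: w)) :
    W C (w ++ [x]) := by
  have h1 : tw [x] w ∈ C.mem := tw_cons_iff.2 h
  have := C.rotUR_mem (k := 0) (l := w.length) (p := col (0 + 1) w.length [x] w) h1
  have e := rotUR_col (k := 0) (l := w.length) x [] w rfl rfl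
  rw [List.nil_append] at e
  rw [e, tw_eq (k := 0) (l := w.length + 1) (u := []) (v := w ++ [x]) rfl (by simp)] at this
  exact this

theorem W.rot {C : PartitionCategory} {u v : List ℕ} (h : W C (u ++ v)) : W C (v ++ u) := by
  induction u generalizing v with
  | nil => simpa using h
  | cons x u ih =>
    have h' : W C ((u ++ v) ++ [x]) := W.rot1 h
    rw [List.append_assoc] at h'
    have := ih h'
    simpa using this

theorem W.rev {C : PartitionCategory} {w : List ℕ} (h : W C w) : W C w.reverse := by
  have := C.involution_mem (p := col _ _ [] w) h
  rw [involution_col] at this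
  have h2 : tw w [] ∈ C.mem := this
  rw [tw_iff] at h2
  simpa using h2

theorem W.append {C : PartitionCategory} {w w' : List ℕ} (h : W C w) (h' : W C w')
    (hd : ∀ a ∈ w, a ∉ w') : W C (w ++ w') := by
  have := C.tensor_mem (p := col _ _ [] w) (q := col _ _ [] w') h h'
  rw [tensor_col [] w [] w' rfl rfl rfl rfl (by simpa using hd),
    tw_eq (k := ([] : List ℕ).length + ([] : List ℕ).length) (l := w.length + w'.length)
      (u := [] ++ []) (v := w ++ w') rfl (by simp)] at this
  exact this

/-- Only the partition induced by a colouring matters. -/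
theorem W.congr {C : PartitionCategory} {w : List ℕ} {f g : ℕ → ℕ} (h : W C (w.map f))
    (hfg : ∀ a ∈ w, ∀ b ∈ w, (f a = f b ↔ g a = g b)) : W C (w.map g) := by
  have : col 0 w.length [] (w.map f) = col 0 w.length [] (w.map g) := by
    ext x y
    unfold col
    rw [Setoid.ker_def, Setoid.ker_def]
    rcases x with x | x
    · exact x.elim0
    rcases y with y | y
    · exact y.elim0
    simp only [Sum.elim_inr]
    rw [getD_map' f x.2, getD_map' f y.2, getD_map' g x.2, getD_map' g y.2]
    exact hfg _ (getD_mem x.2) _ (getD_mem y.2)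
  unfold W at h ⊢
  rw [← tw_eq (k := 0) (l := w.length) rfl (by simp)] at h ⊢
  rwa [← this]

theorem W.rename {C : PartitionCategory} {w : List ℕ} {g : ℕ → ℕ} (h : W C w)
    (hg : ∀ a ∈ w, ∀ b ∈ w, g a = g b → a = b) : W C (w.map g) := by
  have h' : W C (w.map id) := by simpa using h
  exact h'.congr fun a ha b hb => ⟨fun e => congrArg g e, hg a ha b hb⟩

theorem W_pair (C : PartitionCategory) (x : ℕ) : W C [x, x] := by
  have h := C.id_mem
  rw [idPartition_eq, tw_eq (k := 1) (l := 1) (u := [0]) (v := [0]) rfl rfl, tw_iff] at h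
  have := W.rename (g := fun _ => x) h (by simp)
  simpa using this

theorem exists_fresh (w : List ℕ) : ∃ c, c ∉ w := by
  obtain ⟨c, hc⟩ := Infinite.exists_notMem_finset w.toFinset
  exact ⟨c, by simpa using hc⟩

/-- Composition with a partition on two upper points in one block. -/
theorem W_comp {C : PartitionCategory} {w : List ℕ} {x y c n : ℕ} (h : W C (w ++ [x, y]))
    (hc : c ∉ w ++ [x, y]) (h' : W C ([c, c] ++ List.replicate n c)) :
    W C (w.map (glue x y) ++ List.replicate n y) := by
  have h1 : tw w.reverse [x, y] ∈ C.mem := by rw [tw_iff]; simpa using h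
  have h2 : tw [c, c] (List.replicate n c) ∈ C.mem := by rw [tw_iff]; simpa using h'
  have h3 := C.comp_mem (p := col _ 2 w.reverse [x, y]) (q := col 2 _ [c, c] _) h1 h2
  simp only [List.mem_append, not_or, List.mem_cons, List.not_mem_nil] at hc
  obtain ⟨hcw, hcx, hcy, -⟩ := hc
  have key := comp_col (l := 2) w.reverse (List.replicate n c) [(x, c), (y, c)] rfl rfl rfl (by
    intro a ha hb
    have hb' : a = c := by
      simp only [List.map_cons, List.map_nil, List.mem_append, List.mem_cons, List.not_mem_nil,
        or_false, List.mem_replicate] at hb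
      tauto
    subst hb'
    simp only [List.map_cons, List.map_nil, List.mem_append, List.mem_cons, List.not_mem_nil,
        or_false, List.mem_reverse] at ha
    tauto) (fun z => if z = c then y else glue x y z) (by
      intro e he
      simp only [List.mem_cons, List.not_mem_nil, or_false] at he
      rcases he with rfl | rfl
      · simp [glue]
      · simp [glue]) (by
      intro z
      have r1 : Relation.EqvGen (fun a b => (a, b) ∈ [(x, c), (y, c)]) x c :=
        Relation.EqvGen.rel _ _ (by simp)
      have r2 : Relation.EqvGen (fun a b => (a, b) ∈ [(x, c), (y, c)]) y c :=
        Relation.EqvGen.rel _ _ (by simp)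
      simp only [glue]
      split_ifs with h1 h2
      · subst h1; exact r2.symm _ _
      · subst h2; exact r1.trans _ _ _ (r2.symm _ _)
      · exact Relation.EqvGen.refl _)
  simp only [List.map_cons, List.map_nil] at key
  rw [key, tw_eq (by simp) (by simp), tw_iff] at h3
  have e1 : List.map (fun z => if z = c then y else glue x y z) w = w.map (glue x y) := by
    apply List.map_congr_left
    intro z hz
    rw [if_neg]
    rintro rfl; exact hcw hz
  rw [← List.map_reverse, List.reverse_reverse, e1] at h3
  simpa using h3

theorem W.contract_end {C : PartitionCategory} {w : List ℕ} {x y : ℕ} (h : W C (w ++ [x, y])) :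
    W C (w.map (glue x y)) := by
  obtain ⟨c, hc⟩ := exists_fresh (w ++ [x, y])
  simpa using W_comp (n := 0) h hc (W_pair C c)

theorem W_nil (C : PartitionCategory) : W C [] := W.contract_end (w := []) (W_pair C 0)

theorem W.contract {C : PartitionCategory} {u v : List ℕ} {x y : ℕ} (h : W C (u ++ [x, y] ++ v)) :
    W C ((u ++ v).map (glue x y)) := by
  have h1 : W C ((v ++ u) ++ [x, y]) := by
    have := h.rot
    simpa using this
  have := h1.contract_end
  rw [List.map_append] at this ⊢
  exact this.rot

theorem glue_self (x : ℕ) : glue x x = id := by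
  funext z; unfold glue; split_ifs with h <;> simp [h]

theorem W.delete {C : PartitionCategory} {u v : List ℕ} {x : ℕ} (h : W C (u ++ [x, x] ++ v)) :
    W C (u ++ v) := by
  have := h.contract
  rwa [glue_self, List.map_id] at this

/-- Categories containing the four block partition. -/
def Four (C : PartitionCategory) : Prop :=
  (⟨0, 4, fourBlock⟩ : Σ k l : ℕ, Partition k l) ∈ C.mem

theorem Four.word {C : PartitionCategory} (hC : Four C) (c : ℕ) : W C [c, c, c, c] := by
  unfold Four at hC
  rw [fourBlock_eq, tw_eq (k := 0) (l := 4) (u := []) (v := [0, 0, 0, 0]) rfl rfl] at hC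
  have := W.rename (g := fun _ => c) (show W C [0, 0, 0, 0] from hC) (by simp)
  simpa using this

/-- Merging the blocks of two neighbouring points. -/
theorem W.merge {C : PartitionCategory} (hC : Four C) {u v : List ℕ} {x y : ℕ}
    (h : W C (u ++ [x, y] ++ v)) : W C ((u ++ [x, y] ++ v).map (glue x y)) := by
  have h1 : W C ((v ++ u) ++ [x, y]) := by
    have := h.rot
    simpa using this
  obtain ⟨c, hc⟩ := exists_fresh ((v ++ u) ++ [x, y])
  have h2 := W_comp (n := 2) h1 hc (hC.word c)
  have e : [x, y].map (glue x y) = [y, y] := by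
    simp [glue]
  have h3 : W C (v.map (glue x y) ++ (u.map (glue x y) ++ [y, y])) := by simpa using h2
  have := h3.rot
  rw [List.map_append, List.map_append, e]
  exact this

/-- Merging in the other direction. -/
theorem W.merge' {C : PartitionCategory} (hC : Four C) {u v : List ℕ} {x y : ℕ}
    (h : W C (u ++ [x, y] ++ v)) : W C ((u ++ [x, y] ++ v).map (glue y x)) := by
  refine (h.merge hC).congr fun a _ b _ => ?_
  unfold glue
  split_ifs <;> simp_all <;> tauto

/-- Contracting in the other direction. -/
theorem W.contract' {C : PartitionCategory} {u v : List ℕ} {x y : ℕ}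
    (h : W C (u ++ [x, y] ++ v)) : W C ((u ++ v).map (glue y x)) := by
  refine h.contract.congr fun a _ b _ => ?_
  unfold glue
  split_ifs <;> simp_all <;> tauto

/-- Inserting a fresh pair. -/
theorem W.insert_fresh {C : PartitionCategory} {u v : List ℕ} {x : ℕ} (h : W C (u ++ v))
    (hx : x ∉ u ++ v) : W C (u ++ [x, x] ++ v) := by
  have h1 : W C ((v ++ u) ++ [x, x]) := by
    refine h.rot.append (W_pair C x) ?_
    intro a ha hb
    have : a = x := by simpa using hb
    subst this
    exact hx (by simpa [or_comm] using ha)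
  rw [List.append_assoc] at h1
  exact h1.rot

/-- Replacing a point by three points. -/
theorem W.insert_triple {C : PartitionCategory} (hC : Four C) {u v : List ℕ} {x : ℕ}
    (h : W C (u ++ x :: v)) : W C (u ++ x :: x :: x :: v) := by
  obtain ⟨c, hc⟩ := exists_fresh (u ++ x :: v)
  have h1 := W.insert_fresh (u := u ++ [x]) (v := v) (x := c) (by simpa using h) (by simpa using hc)
  have h2 := W.merge' hC (u := u) (x := x) (y := c) (v := c :: v) (by simpa using h1)
  have e : ∀ l : List ℕ, c ∉ l → l.map (glue c x) = l := by
    intro l hl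
    conv_rhs => rw [← List.map_id l]
    apply List.map_congr_left
    intro z hz
    unfold glue
    rw [if_neg (by rintro rfl; exact hl hz)]; rfl
  simp only [List.mem_append, List.mem_cons, not_or] at hc
  rw [List.map_append, List.map_append, e u hc.1] at h2
  simp only [List.map_cons, e v hc.2.2, List.map_nil] at h2
  have hx : glue c x x = x := by simp [glue]
  have hcx : glue c x c = x := by simp [glue]
  simpa [hx, hcx] using h2

/-! ### Hyperoctahedral categories on the level of words -/

theorem W_two {C : PartitionCategory} {a b : ℕ} (hab : a ≠ b) (h : W C [a, b]) : W C [0, 1] := by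
  have := W.rename (g := fun z => if z = a then 0 else 1) h (by
    intro x hx y hy
    simp only [List.mem_cons, List.not_mem_nil, or_false] at hx hy
    rcases hx with rfl | rfl <;> rcases hy with rfl | rfl <;> simp [hab, hab.symm])
  simpa [hab.symm] using this

theorem no_one {C : PartitionCategory} (hD : ¬ W C [0, 1]) (a : ℕ) : ¬ W C [a] := by
  intro h
  have h' : W C [a + 1] := W.rename (g := fun z => z + 1) h (by simp)
  exact hD (W_two (a := a) (b := a + 1) (by omega) (h.append h' (by simp)))

theorem no_single {C : PartitionCategory} (hD : ¬ W C [0, 1]) (n : ℕ) :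
    ∀ (u : List ℕ) (a : ℕ), u.length ≤ n → a ∉ u → ¬ W C (a :: u) := by
  induction n with
  | zero =>
    intro u a hu _ h
    obtain rfl : u = [] := by simpa using hu
    exact no_one hD a h
  | succ n ih =>
    intro u a hu ha h
    rcases u with _ | ⟨b, _ | ⟨c, t⟩⟩
    · exact no_one hD a h
    · exact hD (W_two (by simpa using ha) h)
    · have h1 := W.contract (u := [a]) (x := b) (y := c) (v := t) h
      simp only [List.mem_cons, not_or] at ha
      have e : glue b c a = a := by unfold glue; rw [if_neg ha.1]
      have h2 : W C (a :: t.map (glue b c)) := by simpa [e] using h1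
      refine ih _ a (by simp at hu ⊢; omega) ?_ h2
      rw [List.mem_map]
      rintro ⟨z, hz, hza⟩
      unfold glue at hza
      split_ifs at hza
      · exact ha.2.1 hza.symm
      · subst hza; exact ha.2.2 hz

theorem no_odd {C : PartitionCategory} (hD : ¬ W C [0, 1]) (n : ℕ) :
    ∀ w : List ℕ, w.length = 2 * n + 1 → ¬ W C w := by
  induction n with
  | zero =>
    intro w hw h
    rcases w with _ | ⟨a, _ | ⟨b, t⟩⟩ <;> simp at hw
    exact no_one hD a h
  | succ n ih =>
    intro w hw h
    rcases w with _ | ⟨a, _ | ⟨b, t⟩⟩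
    · simp at hw
    · simp at hw
    · have h1 := W.contract (u := []) (x := a) (y := b) (v := t) h
      exact ih _ (by simp at hw ⊢; omega) h1

/-- The conclusion: the fat crossing or the pair positioner belongs to `C` (as words). -/
def Goal (C : PartitionCategory) : Prop :=
  W C [1, 1, 0, 0, 1, 1, 0, 0] ∨ W C [1, 0, 0, 1, 0, 0]

theorem goal_fat {C : PartitionCategory} {x y : ℕ} (hxy : x ≠ y)
    (h : W C [x, x, y, y, x, x, y, y]) : Goal C := by
  left
  have := W.rename (g := fun z => if z = x then 1 else 0) h (by
    intro a ha b hb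
    have ha' : a = x ∨ a = y := by simp at ha; tauto
    have hb' : b = x ∨ b = y := by simp at hb; tauto
    rcases ha' with rfl | rfl <;> rcases hb' with rfl | rfl <;> simp [hxy, hxy.symm])
  simpa [hxy.symm] using this

theorem goal_pp {C : PartitionCategory} {x y : ℕ} (hxy : x ≠ y)
    (h : W C [x, y, y, x, y, y]) : Goal C := by
  right
  have := W.rename (g := fun z => if z = x then 1 else 0) h (by
    intro a ha b hb
    have ha' : a = x ∨ a = y := by simp at ha; tauto
    have hb' : b = x ∨ b = y := by simp at hb; tauto
    rcases ha' with rfl | rfl <;> rcases hb' with rfl | rfl <;> simp [hxy, hxy.symm])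
  simpa [hxy.symm] using this

theorem W.delete_mirror {C : PartitionCategory} {A D : List ℕ} (B : List ℕ)
    (h : W C (A ++ B ++ (B.reverse ++ D))) : W C (A ++ D) := by
  induction B generalizing A D with
  | nil => simpa using h
  | cons x B ih =>
    have h1 : W C ((A ++ [x]) ++ ([x] ++ D)) := by
      apply ih
      simpa using h
    exact W.delete (u := A) (x := x) (v := D) (by simpa using h1)

/-- Gluing a word to its mirror image. -/
theorem doubling {C : PartitionCategory} {A B : List ℕ} {s t : ℕ} (hst : s ≠ t)
    (hl : ∀ z ∈ A ++ B, z = s ∨ z = t) (h : W C (A ++ B ++ [s, t])) : W C (A ++ A.reverse) := by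
  obtain ⟨N, hN⟩ : ∃ N, s + t < N := ⟨s + t + 1, by omega⟩
  have h1 : W C ((A ++ B ++ [s, t]) ++ (A ++ B ++ [s, t]).reverse.map (fun z => z + N)) := by
    refine h.append (h.rev.rename (by simp)) ?_
    intro a ha hb
    have ha' : a = s ∨ a = t := by
      rw [List.mem_append] at ha
      rcases ha with ha | ha
      · exact hl a ha
      · simpa using ha
    obtain ⟨c, _, hc⟩ := List.mem_map.1 hb
    omega
  have h2 := W.contract' (u := A ++ B ++ [s]) (x := t) (y := t + N)
    (v := (s + N) :: (B.reverse ++ A.reverse).map (fun z => z + N)) (by simpa using h1)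
  have id1 : ∀ (f : ℕ → ℕ) (l : List ℕ), (∀ z ∈ l, f z = z) → l.map f = l := by
    intro f l hf
    conv_rhs => rw [← List.map_id l]
    exact List.map_congr_left hf
  have g1 : ∀ z, z = s ∨ z = t → glue (t + N) t z = z := by
    intro z hz; unfold glue; rw [if_neg (by omega)]
  have g2 : ∀ z, z = s ∨ z = t → glue (s + N) s z = z := by
    intro z hz; unfold glue; rw [if_neg (by omega)]
  have e1 : (A ++ B ++ [s]).map (glue (t + N) t) = A ++ B ++ [s] := by
    apply id1
    intro z hz
    rw [List.mem_append] at hz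
    rcases hz with hz | hz
    · exact g1 z (hl z hz)
    · exact g1 z (by left; simpa using hz)
  have e2 : glue (t + N) t (s + N) = s + N := by
    unfold glue; rw [if_neg (by omega)]
  rw [List.map_append, e1, List.map_cons, e2] at h2
  have h3 := W.contract' (u := A ++ B) (x := s) (y := s + N)
    (v := ((B.reverse ++ A.reverse).map (fun z => z + N)).map (glue (t + N) t))
    (C := C) (by rw [List.append_assoc] at h2 ⊢; exact h2)
  rw [List.map_append, id1 _ (A ++ B) (fun z hz => g2 z (hl z hz))] at h3
  rw [List.map_map, List.map_map, id1 _ (B.reverse ++ A.reverse)] at h3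
  · exact W.delete_mirror B h3
  · intro z hz
    have hz' : z = s ∨ z = t := hl z (by simpa [or_comm] using hz)
    simp only [Function.comp, glue]
    rcases hz' with rfl | rfl
    · have hne : ¬ (z + N = t + N) := by omega
      simp only [if_neg hne, if_true]
    · have hne : ¬ (z = s + N) := by omega
      simp only [if_true, if_neg hne]

theorem W_red {C : PartitionCategory} {u v : List ℕ} {x : ℕ} (n : ℕ) :
    W C (u ++ List.replicate (n + 1) x ++ v) →
    ∃ e, (e = 1 ∨ e = 2) ∧ W C (u ++ List.replicate e x ++ v) := by
  induction n using Nat.strong_induction_on with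
  | _ n ih =>
    intro h
    rcases n with _ | _ | n
    · exact ⟨1, Or.inl rfl, h⟩
    · exact ⟨2, Or.inr rfl, h⟩
    · refine ih n (by omega) ?_
      have := W.delete (u := u) (x := x) (v := List.replicate (n + 1) x ++ v) (by
        simpa [List.replicate_succ] using h)
      simpa using this

theorem goal_abab {C : PartitionCategory} (hC : Four C) {x y : ℕ} (hxy : x ≠ y)
    (h : W C [x, y, x, y]) : Goal C := by
  have h1 := W.insert_triple hC (u := [x, y]) (x := x) (v := [y]) h
  have h2 := doubling (A := [x, y, x]) (B := [x]) (s := x) (t := y) hxy (by simp) h1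
  have h3 := W.rot (u := [x]) (v := [y, x, x, y, x]) (by simpa using h2)
  exact goal_pp hxy.symm h3

theorem goal_runs {C : PartitionCategory} (hC : Four C) (hD : ¬ W C [0, 1]) {x y : ℕ} (hxy : x ≠ y)
    (e1 e2 e3 e4 : ℕ)
    (h : W C (List.replicate (e1 + 1) x ++ List.replicate (e2 + 1) y ++
      List.replicate (e3 + 1) x ++ List.replicate (e4 + 1) y)) : Goal C := by
  obtain ⟨f1, hf1, h1⟩ := W_red (u := []) e1 (by simpa using h)
  obtain ⟨f2, hf2, h2⟩ := W_red (u := List.replicate f1 x) e2 (by simpa using h1)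
  obtain ⟨f3, hf3, h3⟩ := W_red (u := List.replicate f1 x ++ List.replicate f2 y) e3
    (by simpa using h2)
  obtain ⟨f4, hf4, h4⟩ := W_red (v := [])
    (u := List.replicate f1 x ++ List.replicate f2 y ++ List.replicate f3 x) e4
    (by simpa using h3)
  by_cases hpar : (f1 + f2 + f3 + f4) % 2 = 1
  · exact absurd h4 (no_odd hD ((f1 + f2 + f3 + f4) / 2) _ (by simp; omega))
  clear h h1 h2 h3
  rcases hf1 with rfl | rfl <;> rcases hf2 with rfl | rfl <;> rcases hf3 with rfl | rfl <;>
    rcases hf4 with rfl | rfl <;> simp [List.replicate] at h4 hpar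
  · exact goal_abab hC hxy h4
  · -- x y xx yy
    have := W.delete (u := [x, y]) (x := x) (v := [y, y]) h4
    have := W.delete (u := [x, y]) (x := y) (v := []) this
    exact absurd (W_two hxy this) hD
  · -- x yy x yy
    exact goal_pp hxy h4
  · -- x yy xx y
    have := W.delete (u := [x]) (x := y) (v := [x, x, y]) h4
    have := W.delete (u := [x]) (x := x) (v := [y]) this
    exact absurd (W_two hxy this) hD
  · -- xx y x yy
    have := W.delete (u := [x, x, y, x]) (x := y) (v := []) h4
    have := W.delete (u := []) (x := x) (v := [y, x]) this
    exact absurd (W_two hxy.symm this) hD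
  · -- xx y xx y
    exact goal_pp hxy.symm (W.rot (u := [x, x]) (v := [y, x, x, y]) h4)
  · -- xx yy x y
    have := W.delete (u := []) (x := x) (v := [y, y, x, y]) h4
    have := W.delete (u := []) (x := y) (v := [x, y]) this
    exact absurd (W_two hxy this) hD
  · exact goal_fat hxy h4

theorem runs1 {a b : ℕ} (v : List ℕ) (hl : ∀ z ∈ v, z = a ∨ z = b)
    (h1 : [b].Sublist v) (h2 : ¬ [a, b].Sublist v) :
    ∃ k l, v = List.replicate (k + 1) b ++ List.replicate l a := by
  induction v with
  | nil => simp at h1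
  | cons x v ih =>
    have hx : x = b := by
      rcases hl x (by simp) with rfl | rfl
      · by_cases hb : [b].Sublist v
        · exact absurd (hb.cons₂ x) h2
        · rcases List.sublist_cons_iff.1 h1 with h | ⟨r, hr, h⟩
          · exact absurd h hb
          · simp at hr; exact hr.1.symm
      · rfl
    subst hx
    by_cases hb : [x].Sublist v
    · obtain ⟨k, l, rfl⟩ := ih (fun z hz => hl z (by simp [hz])) hb (fun h => h2 (h.cons x))
      exact ⟨k + 1, l, by simp [List.replicate_succ]⟩
    · refine ⟨0, v.length, ?_⟩
      have : v = List.replicate v.length a := by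
        rw [List.eq_replicate_iff]
        refine ⟨rfl, fun z hz => ?_⟩
        rcases hl z (by simp [hz]) with h | rfl
        · exact h
        · exact absurd (by simpa using hz) hb
      rw [← this]; rfl

theorem runs2 {a b : ℕ} (hab : a ≠ b) (v : List ℕ) (hl : ∀ z ∈ v, z = a ∨ z = b)
    (h1 : [a, b].Sublist v) (h2 : ¬ [b, a, b].Sublist v) :
    ∃ j k l, v = List.replicate (j + 1) a ++ List.replicate (k + 1) b ++ List.replicate l a := by
  induction v with
  | nil => simp at h1
  | cons x v ih =>
    have hl' : ∀ z ∈ v, z = a ∨ z = b := fun z hz => hl z (by simp [hz])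
    rcases hl x (by simp) with rfl | rfl
    · by_cases hb : [x, b].Sublist v
      · obtain ⟨j, k, l, rfl⟩ := ih hl' hb (fun h => h2 (h.cons x))
        exact ⟨j + 1, k, l, by simp [List.replicate_succ]⟩
      · obtain ⟨k, l, rfl⟩ := runs1 v hl' (List.cons_sublist_cons.1 h1) hb
        exact ⟨0, k, l, by simp⟩
    · have : [a, x].Sublist v := by
        rcases List.sublist_cons_iff.1 h1 with h | ⟨r, hr, h⟩
        · exact h
        · simp at hr; exact absurd hr.1 hab
      exact absurd (this.cons₂ x) h2

theorem runs3 {a b : ℕ} (hab : a ≠ b) (v : List ℕ) (hl : ∀ z ∈ v, z = a ∨ z = b)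
    (h1 : [b, a, b].Sublist v) (h2 : ¬ [a, b, a, b].Sublist v) :
    ∃ i j k l, v = List.replicate (i + 1) b ++ List.replicate (j + 1) a ++
      List.replicate (k + 1) b ++ List.replicate l a := by
  induction v with
  | nil => simp at h1
  | cons x v ih =>
    have hl' : ∀ z ∈ v, z = a ∨ z = b := fun z hz => hl z (by simp [hz])
    rcases hl x (by simp) with rfl | rfl
    · have : [b, x, b].Sublist v := by
        rcases List.sublist_cons_iff.1 h1 with h | ⟨r, hr, h⟩
        · exact h
        · simp at hr; exact absurd hr.1.symm hab
      exact absurd (this.cons₂ x) h2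
    · by_cases hb : [x, a, x].Sublist v
      · obtain ⟨i, j, k, l, rfl⟩ := ih hl' hb (fun h => h2 (h.cons x))
        exact ⟨i + 1, j, k, l, by simp [List.replicate_succ]⟩
      · obtain ⟨j, k, l, rfl⟩ := runs2 hab v hl' (List.cons_sublist_cons.1 h1) hb
        exact ⟨0, j, k, l, by simp⟩

/-- A crossing word in `C` with two letters, starting with a double letter, where the
remaining word is noncrossing. -/
theorem goal_double {C : PartitionCategory} (hC : Four C) (hD : ¬ W C [0, 1]) {a b : ℕ}
    (hab : a ≠ b) (v : List ℕ) (hl : ∀ z ∈ v, z = a ∨ z = b)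
    (hc : Crossing (a :: a :: v)) (hn : ¬ Crossing v) (h : W C (a :: a :: v)) : Goal C := by
  have key : [b, a, b].Sublist v := by
    obtain ⟨c, d, hcd, hs⟩ := hc
    have hl2 : ∀ z ∈ a :: a :: v, z = a ∨ z = b := by
      intro z hz
      simp only [List.mem_cons] at hz
      rcases hz with h | h | h
      · exact Or.inl h
      · exact Or.inl h
      · exact hl z h
    have h1 := hl2 c (hs.subset (by simp))
    have h2 := hl2 d (hs.subset (by simp))
    have drop : ∀ r : List ℕ, (b :: r).Sublist (a :: a :: v) → (b :: r).Sublist v := by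
      intro r hr
      rcases List.sublist_cons_iff.1 hr with h | ⟨_, hr, _⟩
      · rcases List.sublist_cons_iff.1 h with h | ⟨_, hr, _⟩
        · exact h
        · simp at hr; exact absurd hr.1.symm hab
      · simp at hr; exact absurd hr.1.symm hab
    rcases h1 with rfl | rfl
    · rcases h2 with rfl | rfl
      · exact absurd rfl hcd
      · exact drop _ ((List.sublist_cons_self c _).trans hs)
    · rcases h2 with rfl | rfl
      · exact (show ([c, d, c] : List ℕ).Sublist [c, d, c, d] from
          List.sublist_append_left [c, d, c] [d]).trans (drop _ hs)
      · exact absurd rfl hcd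
  obtain ⟨i, j, k, l, rfl⟩ := runs3 hab v hl key (fun h => hn ⟨a, b, hab, h⟩)
  refine goal_runs hC hD hab (l + 1) i j k ?_
  have := W.rot (u := a :: a :: (List.replicate (i + 1) b ++ List.replicate (j + 1) a ++
      List.replicate (k + 1) b)) (v := List.replicate l a) (by simpa using h)
  have e : List.replicate (l + 1 + 1) a = List.replicate l a ++ [a, a] := by
    rw [show l + 1 + 1 = l + 2 from rfl, List.replicate_add]; rfl
  rw [e]
  simpa using this

theorem goal_two_letters {C : PartitionCategory} (hC : Four C) (hD : ¬ W C [0, 1]) {a b : ℕ}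
    (hab : a ≠ b) (n : ℕ) : ∀ w : List ℕ, w.length ≤ n → (∀ z ∈ w, z = a ∨ z = b) →
    Crossing w → W C w → Goal C := by
  induction n with
  | zero =>
    rintro w hw - ⟨c, d, -, hs⟩ -
    have := hs.length_le
    simp at this
    omega
  | succ n ih =>
    intro w hw hl hc h
    by_cases hdbl : ∃ u v x t, w = u ++ v ∧ v ++ u = x :: x :: t
    · obtain ⟨u, v, x, t, rfl, he⟩ := hdbl
      have hl' : ∀ z ∈ x :: x :: t, z = a ∨ z = b := by
        intro z hz
        rw [← he] at hz
        exact hl z (by simpa [or_comm] using hz)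
      have hlen : t.length + 2 = u.length + v.length := by
        have := congrArg List.length he
        simp at this; omega
      have h' := h.rot
      have hc' := hc.rot
      rw [he] at h' hc'
      have ht : ∀ z ∈ t, z = a ∨ z = b := fun z hz => hl' z (by simp [hz])
      by_cases hct : Crossing t
      · exact ih t (by simp at hw; omega) ht hct
          (by simpa using W.delete (u := []) (x := x) (v := t) h')
      · rcases hl' x (by simp) with rfl | rfl
        · exact goal_double hC hD hab t ht hc' hct h'
        · exact goal_double hC hD hab.symm t (fun z hz => (ht z hz).symm) hc' hct h'
    · have hlen : 4 ≤ w.length := by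
        obtain ⟨c, d, -, hs⟩ := hc
        simpa using hs.length_le
      have nd : ∀ u x v, w ≠ u ++ x :: x :: v := by
        rintro u x v rfl
        exact hdbl ⟨u, x :: x :: v, x, v ++ u, rfl, rfl⟩
      rcases w with _ | ⟨x, _ | ⟨y, _ | ⟨z, B⟩⟩⟩
      · simp at hlen
      · simp at hlen
      · simp at hlen
      have hxy : x ≠ y := by rintro rfl; exact nd [] x _ rfl
      have hyz : y ≠ z := by rintro rfl; exact nd [x] y _ rfl
      have lx := hl x (by simp)
      have ly := hl y (by simp)
      have lz := hl z (by simp)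
      have hzx : z = x := by omega
      subst hzx
      rcases List.eq_nil_or_concat B with rfl | ⟨B, t, rfl⟩
      · simp at hlen
      rw [List.concat_eq_append] at *
      rcases List.eq_nil_or_concat B with rfl | ⟨B, s, rfl⟩
      · have lt := hl t (by simp)
        have hzt : z ≠ t := by rintro rfl; exact nd [z, y] z _ rfl
        have : t = y := by omega
        subst this
        exact goal_abab hC hxy h
      · rw [List.concat_eq_append] at *
        have hst : s ≠ t := by
          rintro rfl
          exact nd (z :: y :: z :: B) s [] (by simp)
        have ls := hl s (by simp)
        have lt := hl t (by simp)
        have := doubling (A := [z, y, z]) (B := B) (s := s) (t := t) hst (by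
          intro r hr
          have := hl r (by simp at hr ⊢; tauto)
          omega) (by simpa using h)
        exact goal_pp hxy.symm (W.rot (u := [z]) (v := [y, z, z, y, z]) this)

theorem goal_crossing_aux {C : PartitionCategory} (hC : Four C) (hD : ¬ W C [0, 1]) {a b : ℕ}
    (hab : a ≠ b) (n : ℕ) : ∀ w : List ℕ, (w.filter fun z => z ≠ a ∧ z ≠ b).length ≤ n →
    [a, b, a, b].Sublist w → W C w → Goal C := by
  induction n with
  | zero =>
    intro w hw hs h
    refine goal_two_letters hC hD hab w.length w le_rfl ?_ ⟨a, b, hab, hs⟩ h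
    intro z hz
    by_contra hcon
    push Not at hcon
    have : z ∈ w.filter fun z => z ≠ a ∧ z ≠ b := by simp [hz, hcon]
    rw [List.length_eq_zero_iff.1 (Nat.le_zero.1 hw)] at this
    simp at this
  | succ n ih =>
    intro w hw hs h
    by_cases hall : ∀ z ∈ w, z = a ∨ z = b
    · exact goal_two_letters hC hD hab w.length w le_rfl hall ⟨a, b, hab, hs⟩ h
    -- two neighbouring letters, exactly one of which is different from `a` and `b`
    have nb : ∀ w : List ℕ, (∃ z ∈ w, z ≠ a ∧ z ≠ b) → (∃ z ∈ w, z = a ∨ z = b) →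
        ∃ u x y v, w = u ++ [x, y] ++ v ∧
          (((x ≠ a ∧ x ≠ b) ∧ (y = a ∨ y = b)) ∨ ((x = a ∨ x = b) ∧ (y ≠ a ∧ y ≠ b))) := by
      intro w
      induction w with
      | nil => simp
      | cons x w ihw =>
        intro h1 h2
        rcases w with _ | ⟨y, w⟩
        · simp at h1 h2; omega
        by_cases hh : (∃ z ∈ y :: w, z ≠ a ∧ z ≠ b) ∧ (∃ z ∈ y :: w, z = a ∨ z = b)
        · obtain ⟨u, x', y', v, he, hp⟩ := ihw hh.1 hh.2
          exact ⟨x :: u, x', y', v, by rw [he]; simp, hp⟩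
        · refine ⟨[], x, y, w, rfl, ?_⟩
          by_contra hcon
          apply hh
          obtain ⟨z1, m1, p1⟩ := h1
          obtain ⟨z2, m2, p2⟩ := h2
          rw [List.mem_cons] at m1 m2
          constructor
          · rcases m1 with rfl | m1
            · exact ⟨y, by simp, by omega⟩
            · exact ⟨z1, m1, p1⟩
          · rcases m2 with rfl | m2
            · exact ⟨y, by simp, by omega⟩
            · exact ⟨z2, m2, p2⟩
    have step : ∀ x y : ℕ, x ∈ w → (x ≠ a ∧ x ≠ b) → (y = a ∨ y = b) →
        W C (w.map (glue x y)) → Goal C := by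
      intro x y hxw hx hy hW
      refine ih _ ?_ ?_ hW
      · have hlt : ((w.map (glue x y)).filter fun z => z ≠ a ∧ z ≠ b).length <
            (w.filter fun z => z ≠ a ∧ z ≠ b).length := by
          rw [List.filter_map, List.length_map]
          obtain ⟨p, q, rfl⟩ := List.append_of_mem hxw
          have sub : ∀ l : List ℕ,
              (l.filter ((fun z => decide (z ≠ a ∧ z ≠ b)) ∘ glue x y)).length ≤
              (l.filter fun z => z ≠ a ∧ z ≠ b).length := by
            intro l
            apply List.Sublist.length_le
            apply List.monotone_filter_right
            intro z hz
            simp only [Function.comp, glue, decide_eq_true_eq] at hz ⊢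
            split_ifs at hz with hzx
            · rw [hzx]; exact hx
            · exact of_decide_eq_true hz
          have gx : glue x y x = y := by simp [glue]
          have s1 := sub p
          have s2 := sub q
          rw [List.filter_append, List.filter_append, List.filter_cons_of_neg,
            List.filter_cons_of_pos, List.length_append, List.length_append, List.length_cons]
          · omega
          · simpa using hx
          · simp only [Function.comp, gx, decide_eq_true_eq]; omega
        omega
      · have := hs.map (glue x y)
        have ga : glue x y a = a := by unfold glue; rw [if_neg (by omega)]
        have gb : glue x y b = b := by unfold glue; rw [if_neg (by omega)]
        simpa [ga, gb] using this
    push Not at hall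
    obtain ⟨u, x, y, v, rfl, ⟨hx, hy⟩ | ⟨hx, hy⟩⟩ := nb w hall ⟨a, hs.subset (by simp), Or.inl rfl⟩
    · exact step x y (by simp) hx hy (h.merge hC)
    · exact step y x (by simp) hy hx (h.merge' hC)

theorem goal_crossing {C : PartitionCategory} (hC : Four C) (hD : ¬ W C [0, 1]) {w : List ℕ}
    (hc : Crossing w) (h : W C w) : Goal C := by
  obtain ⟨a, b, hab, hs⟩ := hc
  exact goal_crossing_aux hC hD hab _ w le_rfl hs h

/-- A nonempty noncrossing word has a block which is an interval. -/
theorem exists_interval (n : ℕ) : ∀ w : List ℕ, w.length ≤ n → w ≠ [] → ¬ Crossing w →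
    ∃ u x k v, w = u ++ List.replicate (k + 1) x ++ v ∧ x ∉ u ∧ x ∉ v := by
  induction n with
  | zero =>
    intro w hw hne
    exact absurd (by simpa using hw) hne
  | succ n ih =>
    intro w hw hne hn
    rcases w with _ | ⟨x, t⟩
    · exact absurd rfl hne
    by_cases hx : x ∈ t
    · obtain ⟨p, q, rfl, hp⟩ := List.append_of_mem hx |>.elim fun p hp => hp.elim fun q hq =>
        (List.mem_iff_append.1 hx |> fun _ => List.eq_append_cons_of_mem hx)
      simp only [List.length_cons, List.length_append] at hw
      rcases p with _ | ⟨y, p⟩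
      · obtain ⟨u, z, k, v, he, hu, hv⟩ := ih (x :: q) (by simp at hw ⊢; omega) (by simp)
          (fun ⟨c, d, hcd, hs⟩ => hn ⟨c, d, hcd, hs.cons x⟩)
        rcases u with _ | ⟨y, u⟩
        · have hz : x = z := by
            simp [List.replicate_succ] at he; exact he.1
          subst hz
          refine ⟨[], x, k + 1, v, ?_, by simp, hv⟩
          rw [List.nil_append, he]
          simp [List.replicate_succ]
        · have hy : x = y := by simp at he; exact he.1
          subst hy
          refine ⟨x :: x :: u, z, k, v, ?_, ?_, hv⟩
          · rw [List.nil_append, he]; simp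
          · simpa using hu
      · obtain ⟨u, z, k, v, he, hu, hv⟩ := ih (y :: p) (by simp at hw ⊢; omega) (by simp)
          (fun ⟨c, d, hcd, hs⟩ => hn ⟨c, d, hcd,
            (hs.trans (List.sublist_append_left _ _)).cons x⟩)
        have hzm : z ∈ y :: p := by rw [he]; simp
        have hzx : z ≠ x := by rintro rfl; exact hp hzm
        refine ⟨x :: u, z, k, v ++ x :: q, by rw [he]; simp, ?_, ?_⟩
        · simp [hzx, hu]
        · intro hm
          simp only [List.mem_append, List.mem_cons] at hm
          rcases hm with h | h | h
          · exact hv h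
          · exact hzx h
          · apply hn
            refine ⟨x, z, hzx.symm, List.Sublist.cons₂ x ?_⟩
            have s1 : [z].Sublist (y :: p) := by simpa using hzm
            have s2 : [z].Sublist q := by simpa using h
            exact s1.append (s2.cons₂ x)
    · exact ⟨[], x, 0, t, by simp, by simp, hx⟩

/-- The generated category. -/
def genCat (S : Set (Σ k l : ℕ, Partition k l)) : PartitionCategory where
  mem := generated S
  id_mem := fun D _ => D.id_mem
  tensor_mem hp hq := fun D hD => D.tensor_mem (hp D hD) (hq D hD)
  comp_mem hp hq := fun D hD => D.comp_mem (hp D hD) (hq D hD)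
  involution_mem hp := fun D hD => D.involution_mem (hp D hD)
  rotUL_mem hp := fun D hD => D.rotUL_mem (hp D hD)
  rotLU_mem hp := fun D hD => D.rotLU_mem (hp D hD)
  rotUR_mem hp := fun D hD => D.rotUR_mem (hp D hD)
  rotRU_mem hp := fun D hD => D.rotRU_mem (hp D hD)

theorem word_in_four {C D : PartitionCategory} (hC : Four C) (hD : ¬ W C [0, 1])
    (hF : Four D) (hG : ¬ Goal C) (n : ℕ) : ∀ w : List ℕ, w.length ≤ n → W C w → W D w := by
  induction n with
  | zero =>
    intro w hw _
    obtain rfl : w = [] := by simpa using hw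
    exact W_nil D
  | succ n ih =>
    intro w hw h
    by_cases hne : w = []
    · subst hne; exact W_nil D
    obtain ⟨u, x, k, v, rfl, hu, hv⟩ := exists_interval w.length w le_rfl hne
      (fun hc => hG (goal_crossing hC hD hc h))
    rcases k with _ | _ | k
    · have h1 : W C (x :: (v ++ u)) := by
        have := W.rot (u := u) (v := x :: v) (by simpa using h)
        simpa using this
      exact absurd h1 (no_single hD _ _ _ le_rfl (by simp [hu, hv]))
    · have h1 : W C (u ++ v) := W.delete (u := u) (x := x) (v := v) h
      exact W.insert_fresh (ih (u ++ v) (by simp at hw ⊢; omega) h1) (by simp [hu, hv])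
    · have h1 : W C (u ++ (x :: (List.replicate k x ++ v))) :=
        W.delete (u := u) (x := x) (v := x :: (List.replicate k x ++ v))
          (by simpa [List.replicate_succ] using h)
      have := W.insert_triple hF (ih _ (by simp at hw ⊢; omega) h1)
      simpa [List.replicate_succ] using this

theorem fatCross_eq : fatCross = col 4 4 [0, 0, 1, 1] [1, 1, 0, 0] := by
  have key : ∀ x y : Fin 4 ⊕ Fin 4,
      (Sum.elim (fun i : Fin 4 => decide (i.val < 2)) (fun j : Fin 4 => decide (2 ≤ j.val)) x =
      Sum.elim (fun i : Fin 4 => decide (i.val < 2)) (fun j : Fin 4 => decide (2 ≤ j.val)) y) ↔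
      (Sum.elim (fun i : Fin 4 => ([0, 0, 1, 1] : List ℕ).getD i.val 0)
        (fun j : Fin 4 => ([1, 1, 0, 0] : List ℕ).getD j.val 0) x =
      Sum.elim (fun i : Fin 4 => ([0, 0, 1, 1] : List ℕ).getD i.val 0)
        (fun j : Fin 4 => ([1, 1, 0, 0] : List ℕ).getD j.val 0) y) := by decide
  ext x y
  exact key x y

theorem pairPositioner_eq : pairPositioner = col 3 3 [0, 0, 1] [1, 0, 0] := by
  have key : ∀ x y : Fin 3 ⊕ Fin 3,
      (Sum.elim (fun i : Fin 3 => decide (i.val < 2)) (fun j : Fin 3 => decide (1 ≤ j.val)) x =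
      Sum.elim (fun i : Fin 3 => decide (i.val < 2)) (fun j : Fin 3 => decide (1 ≤ j.val)) y) ↔
      (Sum.elim (fun i : Fin 3 => ([0, 0, 1] : List ℕ).getD i.val 0)
        (fun j : Fin 3 => ([1, 0, 0] : List ℕ).getD j.val 0) x =
      Sum.elim (fun i : Fin 3 => ([0, 0, 1] : List ℕ).getD i.val 0)
        (fun j : Fin 3 => ([1, 0, 0] : List ℕ).getD j.val 0) y) := by decide
  ext x y
  exact key x y

theorem doubleSingleton_eq : doubleSingleton = col 0 2 [] [0, 1] := by
  have key : ∀ x y : Fin 0 ⊕ Fin 2, x = y ↔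
      (Sum.elim (fun i : Fin 0 => ([] : List ℕ).getD i.val 0)
        (fun j : Fin 2 => ([0, 1] : List ℕ).getD j.val 0) x =
      Sum.elim (fun i : Fin 0 => ([] : List ℕ).getD i.val 0)
        (fun j : Fin 2 => ([0, 1] : List ℕ).getD j.val 0) y) := by decide
  ext x y
  exact key x y

theorem goal_mem {C : PartitionCategory} (h : Goal C) :
    (⟨4, 4, fatCross⟩ : Σ k l : ℕ, Partition k l) ∈ C.mem ∨ GroupTheoretical C := by
  rcases h with h | h
  · left
    rw [fatCross_eq, tw_eq (k := 4) (l := 4) (u := [0, 0, 1, 1]) (v := [1, 1, 0, 0]) rfl rfl,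
      tw_iff]
    exact h
  · right
    unfold GroupTheoretical
    rw [pairPositioner_eq, tw_eq (k := 3) (l := 3) (u := [0, 0, 1]) (v := [1, 0, 0]) rfl rfl,
      tw_iff]
    exact h

theorem mem_eq_generated (C : PartitionCategory) (hH : Hyperoctahedral C)
    (hf : (⟨4, 4, fatCross⟩ : Σ k l : ℕ, Partition k l) ∉ C.mem) (hg : ¬ GroupTheoretical C) :
    C.mem = generated {(⟨0, 4, fourBlock⟩ : Σ k l : ℕ, Partition k l)} := by
  have hC : Four C := hH.1
  have hD : ¬ W C [0, 1] := by
    intro h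
    apply hH.2
    rw [doubleSingleton_eq, tw_eq (k := 0) (l := 2) (u := []) (v := [0, 1]) rfl rfl]
    exact h
  apply Set.Subset.antisymm
  · rintro ⟨k, l, p⟩ hp
    obtain ⟨u, v, hu, hv, rfl⟩ := exists_tw p
    rw [tw_eq hu hv] at hp ⊢
    have h2 : W (genCat {(⟨0, 4, fourBlock⟩ : Σ k l : ℕ, Partition k l)}) (u.reverse ++ v) := by
      refine word_in_four hC hD ?_ ?_ _ _ le_rfl (tw_iff.1 hp)
      · intro D hD
        exact hD rfl
      · intro hG
        rcases goal_mem hG with h | h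
        · exact hf h
        · exact hg h
    exact tw_iff.2 h2
  · intro x hx
    exact hx C (by rintro _ rfl; exact hC)

end EasyQG

namespace EasyQG

theorem statement9 (C : PartitionCategory) (hH : Hyperoctahedral C) :
    (C.mem = generated {(⟨0, 4, fourBlock⟩ : Σ k l : ℕ, Partition k l)} ∧
      ¬ ((⟨4, 4, fatCross⟩ : Σ k l : ℕ, Partition k l) ∈ C.mem ∧ ¬ GroupTheoretical C) ∧
      ¬ GroupTheoretical C) ∨
    (C.mem ≠ generated {(⟨0, 4, fourBlock⟩ : Σ k l : ℕ, Partition k l)} ∧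
      ((⟨4, 4, fatCross⟩ : Σ k l : ℕ, Partition k l) ∈ C.mem ∧ ¬ GroupTheoretical C) ∧
      ¬ GroupTheoretical C) ∨
    (C.mem ≠ generated {(⟨0, 4, fourBlock⟩ : Σ k l : ℕ, Partition k l)} ∧
      ¬ ((⟨4, 4, fatCross⟩ : Σ k l : ℕ, Partition k l) ∈ C.mem ∧ ¬ GroupTheoretical C) ∧
      GroupTheoretical C) := by
  by_cases hg : GroupTheoretical C
  · refine Or.inr (Or.inr ⟨fun h => ?_, fun h => h.2 hg, hg⟩)
    have hg' := hg
    unfold GroupTheoretical at hg'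
    rw [h] at hg'
    exact pairPositioner_not_nc (gen_nc hg')
  · by_cases hf : (⟨4, 4, fatCross⟩ : Σ k l : ℕ, Partition k l) ∈ C.mem
    · refine Or.inr (Or.inl ⟨fun h => ?_, ⟨hf, hg⟩, hg⟩)
      rw [h] at hf
      exact fatCross_not_nc (gen_nc hf)
    · exact Or.inl ⟨mem_eq_generated C hH hf hg, fun h => hf h.1, hg⟩

end EasyQG
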